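/- Let φ : ℝ⁴ → ℝ⁴ satisfy: for every pair r₁, r₂ ∈ ℝ⁴, if ⟨r₁ − r₂, r₁ − r₂⟩ = 0 then ⟨φ(r₁) − φ(r₂), φ(r₁) − φ(r₂)⟩ = 0. Then at least one of the following holds: (1) there exist a real number c > 0, a Lorentz matrix Q, and a ∈ ℝ⁴ such that φ(r) = c·(Q r) + a for every r ∈ ℝ⁴; (2) there exist r, r' ∈ ℝ⁴ such that ⟨φ(s) − r', φ(s) − r'⟩ = 0 for every s ∈ ℝ⁴ with s ≠ r; (3) there exist lightlike lines ℓ, ℓ' ⊆ ℝ⁴ such that φ(s) ∈ ℓ' for every s ∈ ℝ⁴ with s ∉ ℓ. -/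

import Mathlib

open Matrix

noncomputable section

/-- The Lorentz–Minkowski bilinear form on `ℝ⁴`. -/
def mink (r s : Fin 4 → ℝ) : ℝ :=
  -(r 0 * s 0) - r 1 * s 1 - r 2 * s 2 + r 3 * s 3

/-- The matrix `M = diag(−1, −1, −1, 1)`. -/
def minkM : Matrix (Fin 4) (Fin 4) ℝ :=
  Matrix.diagonal ![-1, -1, -1, 1]

/-- A Lorentz matrix: a real `4×4` matrix `Q` with `Qᵀ M Q = M`. -/
def IsLorentz (Q : Matrix (Fin 4) (Fin 4) ℝ) : Prop :=
  Qᵀ * minkM * Q = minkM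

/-- A lightlike line: an affine line `{r₀ + s·v : s ∈ ℝ}` with `v ≠ 0` and `⟨v, v⟩ = 0`. -/
def IsLightlikeLine (ℓ : Set (Fin 4 → ℝ)) : Prop :=
  ∃ r₀ v : Fin 4 → ℝ, v ≠ 0 ∧ mink v v = 0 ∧ ℓ = {r | ∃ s : ℝ, r = r₀ + s • v}

theorem mink_comm (x y : Fin 4 → ℝ) : mink x y = mink y x := by
  unfold mink; ring

theorem mink_add_left (x y z : Fin 4 → ℝ) : mink (x + y) z = mink x z + mink y z := by
  simp only [mink, Pi.add_apply]; ring

theorem mink_add_right (x y z : Fin 4 → ℝ) : mink x (y + z) = mink x y + mink x z := by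
  simp only [mink, Pi.add_apply]; ring

theorem mink_sub_left (x y z : Fin 4 → ℝ) : mink (x - y) z = mink x z - mink y z := by
  simp only [mink, Pi.sub_apply]; ring

theorem mink_sub_right (x y z : Fin 4 → ℝ) : mink x (y - z) = mink x y - mink x z := by
  simp only [mink, Pi.sub_apply]; ring

theorem mink_smul_left (c : ℝ) (x y : Fin 4 → ℝ) : mink (c • x) y = c * mink x y := by
  simp only [mink, Pi.smul_apply, smul_eq_mul]; ring

theorem mink_smul_right (c : ℝ) (x y : Fin 4 → ℝ) : mink x (c • y) = c * mink x y := by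
  simp only [mink, Pi.smul_apply, smul_eq_mul]; ring

theorem mink_neg_left (x y : Fin 4 → ℝ) : mink (-x) y = -mink x y := by
  simp only [mink, Pi.neg_apply]; ring

theorem mink_neg_right (x y : Fin 4 → ℝ) : mink x (-y) = -mink x y := by
  simp only [mink, Pi.neg_apply]; ring

theorem mink_zero_left (x : Fin 4 → ℝ) : mink 0 x = 0 := by
  simp [mink]

theorem mink_zero_right (x : Fin 4 → ℝ) : mink x 0 = 0 := by
  simp [mink]

/-- Two events are adjacent when they are lightlike. -/
def Adj (x y : Fin 4 → ℝ) : Prop := mink (x - y) (x - y) = 0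

theorem Adj.refl (x : Fin 4 → ℝ) : Adj x x := by
  simp [Adj, mink_zero_left]

theorem Adj.symm {x y : Fin 4 → ℝ} (h : Adj x y) : Adj y x := by
  unfold Adj at *
  rw [← neg_sub x y, mink_neg_left, mink_neg_right, neg_neg, h]

theorem adj_iff (x y : Fin 4 → ℝ) :
    Adj x y ↔ mink x x - 2 * mink x y + mink y y = 0 := by
  unfold Adj
  rw [mink_sub_left, mink_sub_right, mink_sub_right, mink_comm y x]
  constructor <;> intro h <;> linarith

/-- The last coordinate of a nonzero null vector does not vanish. -/
theorem last_ne_zero_of_null {v : Fin 4 → ℝ} (hv : mink v v = 0) (h0 : v ≠ 0) : v 3 ≠ 0 := by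
  intro h3
  apply h0
  unfold mink at hv
  rw [h3] at hv
  have e0 : v 0 = 0 := by nlinarith [sq_nonneg (v 0), sq_nonneg (v 1), sq_nonneg (v 2)]
  have e1 : v 1 = 0 := by nlinarith [sq_nonneg (v 0), sq_nonneg (v 1), sq_nonneg (v 2)]
  have e2 : v 2 = 0 := by nlinarith [sq_nonneg (v 0), sq_nonneg (v 1), sq_nonneg (v 2)]
  ext i
  fin_cases i <;> simpa

theorem null_parallel_of_orthogonal {v w : Fin 4 → ℝ} (hv : mink v v = 0) (h0 : v ≠ 0)
    (hw : mink w w = 0) (hvw : mink v w = 0) : ∃ t : ℝ, w = t • v := by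
  have h3 := last_ne_zero_of_null hv h0
  refine ⟨w 3 / v 3, ?_⟩
  obtain ⟨t, ht⟩ : ∃ t, t = w 3 / v 3 := ⟨_, rfl⟩
  have hw3 : w 3 = t * v 3 := by rw [ht]; field_simp
  rw [← ht]
  unfold mink at hv hw hvw
  rw [hw3] at hw hvw
  have key : (w 0 - t * v 0) ^ 2 + (w 1 - t * v 1) ^ 2 + (w 2 - t * v 2) ^ 2 = 0 := by
    linear_combination -hw + 2 * t * hvw - t ^ 2 * hv
  have e0 : w 0 = t * v 0 := by
    nlinarith [sq_nonneg (w 0 - t * v 0), sq_nonneg (w 1 - t * v 1), sq_nonneg (w 2 - t * v 2)]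
  have e1 : w 1 = t * v 1 := by
    nlinarith [sq_nonneg (w 0 - t * v 0), sq_nonneg (w 1 - t * v 1), sq_nonneg (w 2 - t * v 2)]
  have e2 : w 2 = t * v 2 := by
    nlinarith [sq_nonneg (w 0 - t * v 0), sq_nonneg (w 1 - t * v 1), sq_nonneg (w 2 - t * v 2)]
  ext i
  fin_cases i <;> simpa

/-- Three pairwise lightlike events are collinear. -/
theorem collinear_of_adj {x y z : Fin 4 → ℝ} (hxy : Adj x y) (hyz : Adj y z) (hxz : Adj x z)
    (hne : x ≠ y) : ∃ t : ℝ, z = x + t • (y - x) := by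
  have h1 : mink (y - x) (y - x) = 0 := hxy.symm
  have h2 : mink (z - x) (z - x) = 0 := hxz.symm
  have h3 : mink (y - x) (z - x) = 0 := by
    have h4 : Adj (y - x) (z - x) := by
      unfold Adj at *
      rwa [sub_sub_sub_cancel_right]
    rw [adj_iff] at h4
    linarith
  obtain ⟨t, ht⟩ := null_parallel_of_orthogonal h1 (sub_ne_zero.2 hne.symm) h2 h3
  exact ⟨t, by rw [← ht]; abel⟩

/-- Lightlikeness has no diamonds. -/
theorem adj_of_diamond {p q u w : Fin 4 → ℝ} (hpq : Adj p q) (hne : p ≠ q) (hup : Adj u p)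
    (huq : Adj u q) (hwp : Adj w p) (hwq : Adj w q) : Adj u w := by
  obtain ⟨s, hs⟩ := collinear_of_adj hpq huq.symm hup.symm hne
  obtain ⟨t, ht⟩ := collinear_of_adj hpq hwq.symm hwp.symm hne
  have h1 : mink (q - p) (q - p) = 0 := hpq.symm
  unfold Adj
  have : u - w = (s - t) • (q - p) := by rw [hs, ht, sub_smul]; abel
  rw [this, mink_smul_left, mink_smul_right, h1]; ring

theorem adj_add_smul {x v : Fin 4 → ℝ} (hv : mink v v = 0) (s t : ℝ) :
    Adj (x + s • v) (x + t • v) := by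
  unfold Adj
  have : x + s • v - (x + t • v) = (s - t) • v := by rw [sub_smul]; abel
  rw [this, mink_smul_left, mink_smul_right, hv]; ring

theorem adj_add_smul_self {x v : Fin 4 → ℝ} (hv : mink v v = 0) (s : ℝ) :
    Adj (x + s • v) x := by
  simpa using adj_add_smul (x := x) hv s 0

theorem mink_add_smul_sub (x v y : Fin 4 → ℝ) (hv : mink v v = 0) (s : ℝ) :
    mink (x + s • v - y) (x + s • v - y) = mink (x - y) (x - y) + 2 * s * mink (x - y) v := by
  have : x + s • v - y = (x - y) + s • v := by abel
  rw [this]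
  simp only [mink_add_left, mink_add_right, mink_smul_left, mink_smul_right, hv,
    mink_comm v (x - y)]
  ring

/-- The event on the null line through `x` with direction `v` that is lightlike to `y`. -/
theorem adj_meet {x v y : Fin 4 → ℝ} (hv : mink v v = 0) (h : mink (y - x) v ≠ 0) :
    Adj (x + (mink (y - x) (y - x) / (2 * mink (y - x) v)) • v) y := by
  unfold Adj
  rw [mink_add_smul_sub _ _ _ hv, ← neg_sub y x, mink_neg_left, mink_neg_left, mink_neg_right]
  field_simp
  ring

theorem ne_zero_of_mink_ne_zero {x y : Fin 4 → ℝ} (h : mink x y ≠ 0) : x ≠ 0 := by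
  rintro rfl
  exact h (mink_zero_left y)

/-- Finitely many proper hyperplanes do not cover the light cone. -/
theorem exists_null_generic (l : List (Fin 4 → ℝ)) (hl : ∀ u ∈ l, u ≠ 0) :
    ∃ v : Fin 4 → ℝ, mink v v = 0 ∧ v ≠ 0 ∧ ∀ u ∈ l, mink u v ≠ 0 := by
  let γ : ℝ → (Fin 4 → ℝ) := fun t => ![2 * t, 2 * t ^ 2, t ^ 4 + t ^ 2 - 1, t ^ 4 + t ^ 2 + 1]
  have hγ : ∀ t, mink (γ t) (γ t) = 0 := by
    intro t
    simp [γ, mink]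
    ring
  have hγ0 : ∀ t, γ t ≠ 0 := by
    intro t h
    have := congrFun h 3
    simp [γ] at this
    nlinarith [sq_nonneg (t ^ 2), sq_nonneg t]
  have hfin : ∀ u ∈ l, {t | mink u (γ t) = 0}.Finite := by
    intro u hu
    let p : Polynomial ℝ := Polynomial.C (u 3 - u 2) * Polynomial.X ^ 4
      + Polynomial.C (u 3 - u 2 - 2 * u 1) * Polynomial.X ^ 2
      + Polynomial.C (-2 * u 0) * Polynomial.X + Polynomial.C (u 2 + u 3)
    have hp : p ≠ 0 := by
      intro h
      have c4 : p.coeff 4 = 0 := by rw [h]; simp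
      have c2 : p.coeff 2 = 0 := by rw [h]; simp
      have c1 : p.coeff 1 = 0 := by rw [h]; simp
      have c0 : p.coeff 0 = 0 := by rw [h]; simp
      simp only [p, Polynomial.coeff_add, Polynomial.coeff_C_mul, Polynomial.coeff_X_pow,
        Polynomial.coeff_X, Polynomial.coeff_C] at c4 c2 c1 c0
      norm_num at c4 c2 c1 c0
      apply hl u hu
      ext i
      fin_cases i <;> simp <;> linarith
    refine (p.roots.toFinset.finite_toSet).subset ?_
    intro t ht
    simp only [Finset.mem_coe, Multiset.mem_toFinset]
    rw [Polynomial.mem_roots hp]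
    simp only [Polynomial.IsRoot, p, Polynomial.eval_add, Polynomial.eval_mul, Polynomial.eval_C,
      Polynomial.eval_pow, Polynomial.eval_X]
    have h2 : mink u (γ t) = 0 := ht
    simp [γ, mink] at h2
    linarith
  have hU : (⋃ u ∈ {u | u ∈ l}, {t | mink u (γ t) = 0}).Finite :=
    Set.Finite.biUnion (List.finite_toSet l) hfin
  obtain ⟨t, ht⟩ := hU.infinite_compl.nonempty
  refine ⟨γ t, hγ t, hγ0 t, fun u hu h => ht ?_⟩
  simp only [Set.mem_iUnion]
  exact ⟨u, hu, h⟩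

/-- Null vectors in the same half of the light cone have nonnegative product. -/
theorem mink_nonneg_of_null {v w : Fin 4 → ℝ} (hv : mink v v = 0) (hw : mink w w = 0)
    (h : 0 ≤ v 3 * w 3) : 0 ≤ mink v w := by
  have cs : (v 0 * w 0 + v 1 * w 1 + v 2 * w 2) ^ 2 ≤ (v 3 * w 3) ^ 2 := by
    unfold mink at hv hw
    have e : (v 3 * w 3) ^ 2 = (v 0 ^ 2 + v 1 ^ 2 + v 2 ^ 2) * (w 0 ^ 2 + w 1 ^ 2 + w 2 ^ 2) := by
      have h1 : v 3 ^ 2 = v 0 ^ 2 + v 1 ^ 2 + v 2 ^ 2 := by linarith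
      have h2 : w 3 ^ 2 = w 0 ^ 2 + w 1 ^ 2 + w 2 ^ 2 := by linarith
      rw [mul_pow, h1, h2]
    rw [e]
    nlinarith [sq_nonneg (v 0 * w 1 - v 1 * w 0), sq_nonneg (v 0 * w 2 - v 2 * w 0),
      sq_nonneg (v 1 * w 2 - v 2 * w 1)]
  have := abs_le_of_sq_le_sq' cs h
  unfold mink
  linarith [this.2]

/-- If every vector of the light cone is orthogonal to `u`, then `u = 0`. -/
theorem eq_zero_of_orthogonal {u : Fin 4 → ℝ} (h : ∀ x, mink u x = 0) : u = 0 := by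
  by_contra hu
  obtain ⟨v, -, -, hv⟩ := exists_null_generic [u] (by simpa using hu)
  exact hv u (by simp) (h v)

/-- The inhomogeneous quadratic function with leading part `H (x² + y²) / 2`. -/
def circ (A B C H x y : ℝ) : ℝ := A + B * x + C * y + H * (x ^ 2 + y ^ 2) / 2

/-- Near every point there is a unit direction, out of a fixed finite list, along which a step of
length `d` avoids the two exceptional level sets of `circ`. -/
theorem exists_circ_step {A B C H d : ℝ} (hd : 0 < d) (hQ : 2 * A * H - B ^ 2 - C ^ 2 ≠ 0)
    (h1 : 2 * (H ^ 2 * d ^ 2) < |2 * A * H - B ^ 2 - C ^ 2|) (h2 : |H| * d ^ 2 < 1) (x y : ℝ) :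
    ∃ u w : ℝ, u ^ 2 + w ^ 2 = 1 ∧ 4 / 5 ≤ u ∧ u ≤ 1 ∧ -(3 / 5) ≤ w ∧ w ≤ 3 / 5 ∧
      circ A B C H (x + d * u) (y + d * w) ≠ 0 ∧
      (2 * A * H - B ^ 2 - C ^ 2) * d ^ 2 + 4 * circ A B C H (x + d * u) (y + d * w) ≠ 0 := by
  obtain ⟨Q, hQd⟩ : ∃ Q, Q = 2 * A * H - B ^ 2 - C ^ 2 := ⟨_, rfl⟩
  rw [← hQd] at hQ h1 ⊢
  obtain ⟨F, hF⟩ : ∃ F, F = circ A B C H x y := ⟨_, rfl⟩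
  obtain ⟨g, hg⟩ : ∃ g, g = B + H * x := ⟨_, rfl⟩
  obtain ⟨k, hk⟩ : ∃ k, k = C + H * y := ⟨_, rfl⟩
  have hgk : g ^ 2 + k ^ 2 = 2 * H * F - Q := by
    rw [hg, hk, hF, hQd]; unfold circ; ring
  have hstep : ∀ u w : ℝ, u ^ 2 + w ^ 2 = 1 →
      circ A B C H (x + d * u) (y + d * w) = F + H * d ^ 2 / 2 + (d * g * u + d * k * w) := by
    intro u w huw
    rw [hF, hg, hk]; unfold circ
    linear_combination H * d ^ 2 / 2 * huw
  by_contra hcon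
  have hcon' : ∀ u w : ℝ, u ^ 2 + w ^ 2 = 1 → 4 / 5 ≤ u → u ≤ 1 → -(3 / 5) ≤ w → w ≤ 3 / 5 →
      F + H * d ^ 2 / 2 + (d * g * u + d * k * w) = 0 ∨
      Q * d ^ 2 + 4 * (F + H * d ^ 2 / 2 + (d * g * u + d * k * w)) = 0 := by
    intro u w huw a1 a2 a3 a4
    rw [← hstep u w huw]
    by_contra hno
    push Not at hno
    exact hcon ⟨u, w, huw, a1, a2, a3, a4, hno.1, hno.2⟩
  have c1 := hcon' 1 0 (by norm_num) (by norm_num) (by norm_num) (by norm_num) (by norm_num)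
  have c2 := hcon' (4/5) (3/5) (by norm_num) (by norm_num) (by norm_num) (by norm_num)
    (by norm_num)
  have c3 := hcon' (4/5) (-(3/5)) (by norm_num) (by norm_num) (by norm_num) (by norm_num)
    (by norm_num)
  have c4 := hcon' (12/13) (5/13) (by norm_num) (by norm_num) (by norm_num) (by norm_num)
    (by norm_num)
  have c5 := hcon' (12/13) (-(5/13)) (by norm_num) (by norm_num) (by norm_num) (by norm_num)
    (by norm_num)
  have hk0 : d * k = 0 := by
    rcases c2 with c2 | c2 <;> rcases c3 with c3 | c3 <;> rcases c4 with c4 | c4 <;>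
      rcases c5 with c5 | c5 <;> linarith
  have hg0 : d * g = 0 := by
    rw [hk0] at c2 c4
    rcases c1 with c1 | c1 <;> rcases c2 with c2 | c2 <;> rcases c4 with c4 | c4 <;> linarith
  have hg0' : g = 0 := by simpa [hd.ne'] using hg0
  have hk0' : k = 0 := by simpa [hd.ne'] using hk0
  rw [hg0', hk0'] at hgk c1
  have hHd := abs_lt.1 (by rwa [abs_mul, abs_of_pos (by positivity : 0 < d ^ 2)] :
    |H * d ^ 2| < 1)
  rcases c1 with c1 | c1
  · have : Q = -(H ^ 2 * d ^ 2) := by linear_combination hgk + 2 * H * c1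
    rw [this, abs_neg, abs_of_nonneg (by positivity)] at h1
    nlinarith [mul_nonneg (sq_nonneg H) (sq_nonneg d)]
  · have : H ^ 2 * d ^ 2 = -(Q * (1 + H * d ^ 2 / 2)) := by
      linear_combination hgk + H / 2 * c1
    have h3 : H ^ 2 * d ^ 2 = |Q| * (1 + H * d ^ 2 / 2) := by
      rw [← abs_of_nonneg (by positivity : 0 ≤ H ^ 2 * d ^ 2), this, abs_neg, abs_mul,
        abs_of_pos (by linarith : 0 < 1 + H * d ^ 2 / 2)]
    nlinarith [abs_pos.2 hQ]

/-- Two points at distance less than `2 d` have a common point at distance `d`. -/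
theorem exists_equidistant {d x y x' y' : ℝ}
    (h : (x - x') ^ 2 + (y - y') ^ 2 < 4 * d ^ 2) :
    ∃ z w : ℝ, (z - x) ^ 2 + (w - y) ^ 2 = d ^ 2 ∧ (z - x') ^ 2 + (w - y') ^ 2 = d ^ 2 := by
  obtain ⟨ρ, hρ⟩ : ∃ ρ, ρ = (x - x') ^ 2 + (y - y') ^ 2 := ⟨_, rfl⟩
  have hρ0 : 0 ≤ ρ := by rw [hρ]; positivity
  rcases hρ0.eq_or_lt with h0 | h0
  · have e1 : x = x' := by nlinarith [sq_nonneg (x - x'), sq_nonneg (y - y')]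
    have e2 : y = y' := by nlinarith [sq_nonneg (x - x'), sq_nonneg (y - y')]
    exact ⟨x + d, y, by ring, by rw [e1, e2]; ring⟩
  · obtain ⟨κ, hκ⟩ : ∃ κ, κ = √(d ^ 2 / ρ - 1 / 4) := ⟨_, rfl⟩
    have hκ2 : κ ^ 2 * ρ = d ^ 2 - ρ / 4 := by
      rw [hκ, Real.sq_sqrt]
      · field_simp
      · rw [sub_nonneg, div_le_div_iff₀ (by norm_num) h0]
        linarith
    refine ⟨(x + x') / 2 - κ * (y - y'), (y + y') / 2 + κ * (x - x'), ?_, ?_⟩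
    · rw [hρ] at hκ2
      linear_combination hκ2
    · rw [hρ] at hκ2
      linear_combination hκ2

/-- A function on the plane which takes equal values on most pairs of points at arbitrarily small
distances is locally constant. -/
theorem eventually_eq_of_small_steps {α : Type*} {D : ℝ × ℝ → α} {G : ℝ × ℝ → ℝ}
    (hG : Continuous G) {A B C H : ℝ} (hQ : 2 * A * H - B ^ 2 - C ^ 2 ≠ 0) {p : ℝ × ℝ}
    (hp : G p ≠ 0)
    (hD : ∀ ε > 0, ∃ d, 0 < d ∧ d < ε ∧ ∀ x y x' y' : ℝ, (x - x') ^ 2 + (y - y') ^ 2 = d ^ 2 →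
      G (x, y) ≠ 0 → circ A B C H x' y' ≠ 0 →
      (2 * A * H - B ^ 2 - C ^ 2) * d ^ 2 + 4 * circ A B C H x' y' ≠ 0 → D (x, y) = D (x', y')) :
    ∀ᶠ z in nhds p, D z = D p := by
  obtain ⟨δ, hδ, hGδ⟩ := Metric.eventually_nhds_iff.1 (hG.continuousAt.eventually_ne hp)
  have lim1 : ∀ᶠ d : ℝ in nhds 0, 2 * (H ^ 2 * d ^ 2) < |2 * A * H - B ^ 2 - C ^ 2| := by
    have : Continuous fun d : ℝ => 2 * (H ^ 2 * d ^ 2) := by fun_prop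
    exact this.continuousAt.eventually_lt continuousAt_const (by simpa using hQ)
  have lim2 : ∀ᶠ d : ℝ in nhds 0, |H| * d ^ 2 < 1 := by
    have : Continuous fun d : ℝ => |H| * d ^ 2 := by fun_prop
    exact this.continuousAt.eventually_lt continuousAt_const (by simp)
  obtain ⟨η, hη, hlim⟩ := Metric.eventually_nhds_iff.1 (lim1.and lim2)
  obtain ⟨d, hd, hdε, hbad⟩ := hD (min (δ / 3) η) (lt_min (by linarith) hη)
  have hdδ : d < δ / 3 := hdε.trans_le (min_le_left _ _)
  obtain ⟨hl1, hl2⟩ := hlim (y := d) (by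
    rw [Real.dist_eq, sub_zero, abs_of_pos hd]; exact hdε.trans_le (min_le_right _ _))
  refine Metric.eventually_nhds_iff.2 ⟨d / 4, by linarith, ?_⟩
  rintro ⟨x, y⟩ hz
  obtain ⟨x₀, y₀⟩ := p
  have near : ∀ x y : ℝ, |x - x₀| ≤ 2 * d → |y - y₀| ≤ 2 * d → G (x, y) ≠ 0 := by
    intro x y hx hy
    apply hGδ
    rw [Prod.dist_eq, Real.dist_eq, Real.dist_eq]
    exact max_lt (by linarith) (by linarith)
  rw [Prod.dist_eq, Real.dist_eq, Real.dist_eq, max_lt_iff] at hz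
  obtain ⟨hx, hy⟩ := hz
  simp only at hx hy
  obtain ⟨u, w, n1, a1, a2, a3, a4, g1, g2⟩ := exists_circ_step hd hQ hl1 hl2 x y
  obtain ⟨u', w', n1', a1', a2', a3', a4', g1', g2'⟩ := exists_circ_step hd hQ hl1 hl2 x₀ y₀
  have bx := abs_lt.1 hx
  have scale : ∀ c c' : ℝ, c ≤ c' → d * c ≤ d * c' := fun c c' h => by gcongr
  replace a1 := scale _ _ a1
  replace a2 := scale _ _ a2
  replace a3 := scale _ _ a3
  replace a4 := scale _ _ a4
  replace a1' := scale _ _ a1'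
  replace a2' := scale _ _ a2'
  replace a3' := scale _ _ a3'
  replace a4' := scale _ _ a4'
  have bY := abs_lt.1 hy
  obtain ⟨z, t, e1, e2⟩ := exists_equidistant (x := x + d * u) (y := y + d * w)
    (x' := x₀ + d * u') (y' := y₀ + d * w') (by
      have i1 : (x + d * u - (x₀ + d * u')) ^ 2 ≤ (d / 2) ^ 2 := by
        apply sq_le_sq'
        · linarith
        · linarith
      have i2 : (y + d * w - (y₀ + d * w')) ^ 2 ≤ (3 * d / 2) ^ 2 := by
        apply sq_le_sq'
        · linarith
        · linarith
      nlinarith [mul_pos hd hd])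
  have s1 : D (x, y) = D (x + d * u, y + d * w) :=
    hbad _ _ _ _ (by linear_combination d ^ 2 * n1) (near _ _ (by linarith) (by linarith)) g1 g2
  have s2 : D (x₀, y₀) = D (x₀ + d * u', y₀ + d * w') :=
    hbad _ _ _ _ (by linear_combination d ^ 2 * n1') hp g1' g2'
  have hzt : G (z, t) ≠ 0 := by
    have i1 := abs_le.1 (abs_le_of_sq_le_sq (a := z - (x₀ + d * u')) (b := d)
      (by nlinarith [sq_nonneg (t - (y₀ + d * w'))]) hd.le)
    have i2 := abs_le.1 (abs_le_of_sq_le_sq (a := t - (y₀ + d * w')) (b := d)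
      (by nlinarith [sq_nonneg (z - (x₀ + d * u'))]) hd.le)
    apply near
    · rw [abs_le]; constructor <;> linarith
    · rw [abs_le]; constructor <;> linarith
  have s3 := hbad _ _ _ _ e1 hzt g1 g2
  have s4 := hbad _ _ _ _ e2 hzt g1' g2'
  rw [s1, s2, ← s3, ← s4]

/-- Maps preserving lightlikeness. -/
def Preserving (φ : (Fin 4 → ℝ) → (Fin 4 → ℝ)) : Prop := ∀ x y, Adj x y → Adj (φ x) (φ y)

/-- Two images which lie both on the cone of `r` and on a common line with an event whose image
is not lightlike to `r` agree. -/
theorem Preserving.eq_of_triangle {φ : (Fin 4 → ℝ) → (Fin 4 → ℝ)} (hφ : Preserving φ)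
    {r s y z : Fin 4 → ℝ} (hs : ¬Adj (φ s) r) (hy : Adj (φ y) r) (hz : Adj (φ z) r)
    (hsy : Adj s y) (hsz : Adj s z) (hyz : Adj y z) : φ y = φ z := by
  by_contra hne
  exact hs (adj_of_diamond (hφ _ _ hyz) hne (hφ _ _ hsy) (hφ _ _ hsz) hy.symm hz.symm)

/-- Inversion in the unit hyperboloid. -/
def hypInv (ξ : Fin 4 → ℝ) : Fin 4 → ℝ := (mink ξ ξ)⁻¹ • ξ

theorem mink_hypInv (ξ : Fin 4 → ℝ) : mink (hypInv ξ) (hypInv ξ) = (mink ξ ξ)⁻¹ := by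
  unfold hypInv
  rw [mink_smul_left, mink_smul_right]
  rcases eq_or_ne (mink ξ ξ) 0 with h | h
  · simp [h]
  · field_simp

theorem hypInv_hypInv {ξ : Fin 4 → ℝ} (h : mink ξ ξ ≠ 0) : hypInv (hypInv ξ) = ξ := by
  have : hypInv (hypInv ξ) = (mink (hypInv ξ) (hypInv ξ))⁻¹ • hypInv ξ := rfl
  rw [this, mink_hypInv, inv_inv]
  unfold hypInv
  rw [smul_smul, mul_inv_cancel₀ h, one_smul]

theorem adj_hypInv {ξ η : Fin 4 → ℝ} (hξ : mink ξ ξ ≠ 0) (hη : mink η η ≠ 0) (h : Adj ξ η) :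
    Adj (hypInv ξ) (hypInv η) := by
  rw [adj_iff] at *
  rw [mink_hypInv, mink_hypInv]
  unfold hypInv
  rw [mink_smul_left, mink_smul_right]
  field_simp
  linarith

/-- The null event `v / (2 c)`, the inverse image of the hyperplane `⟨·, v⟩ = c`. -/
def planeInv (v : Fin 4 → ℝ) (c : ℝ) : Fin 4 → ℝ := (2 * c)⁻¹ • v

theorem adj_planeInv {v ξ : Fin 4 → ℝ} (hv : mink v v = 0) (hξ : mink ξ ξ ≠ 0)
    (h : mink ξ v ≠ 0) : Adj (hypInv ξ) (planeInv v (mink ξ v)) := by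
  rw [adj_iff, mink_hypInv]
  unfold hypInv planeInv
  simp only [mink_smul_left, mink_smul_right, hv]
  field_simp
  ring

theorem adj_planeInv_planeInv {v : Fin 4 → ℝ} (hv : mink v v = 0) (c c' : ℝ) :
    Adj (planeInv v c) (planeInv v c') := by
  simpa [planeInv] using adj_add_smul (x := 0) hv (2 * c)⁻¹ (2 * c')⁻¹

theorem adj_zero_planeInv {v : Fin 4 → ℝ} (hv : mink v v = 0) (c : ℝ) :
    Adj 0 (planeInv v c) := by
  simpa [planeInv] using (adj_add_smul_self (x := 0) hv (2 * c)⁻¹).symm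

theorem planeInv_smul {k : ℝ} (hk : k ≠ 0) (v : Fin 4 → ℝ) (c : ℝ) :
    planeInv (k • v) (k * c) = planeInv v c := by
  unfold planeInv
  rw [smul_smul]
  congr 1
  rcases eq_or_ne c 0 with rfl | hc
  · simp
  · field_simp

theorem planeInv_half (v : Fin 4 → ℝ) : planeInv v (1 / 2) = v := by
  simp [planeInv]

section Preserving

variable {φ : (Fin 4 → ℝ) → (Fin 4 → ℝ)} {r : Fin 4 → ℝ}

/-- The image of the event attached to the hyperplane `⟨·, v⟩ = c` lies on the cone of `r`. -/
def Wit (φ : (Fin 4 → ℝ) → (Fin 4 → ℝ)) (r v : Fin 4 → ℝ) (c : ℝ) : Prop :=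
  Adj (φ (planeInv v c)) r

theorem wit_smul {k : ℝ} (hk : k ≠ 0) (v : Fin 4 → ℝ) (c : ℝ) :
    Wit φ r (k • v) (k * c) ↔ Wit φ r v c := by
  unfold Wit
  rw [planeInv_smul hk]

open Classical in
/-- The common image of the events on the null line `ℝ v` whose images lie on the cone of `r`. -/
def dirImage (φ : (Fin 4 → ℝ) → (Fin 4 → ℝ)) (r v : Fin 4 → ℝ) : Fin 4 → ℝ :=
  if h : ∃ c, c ≠ 0 ∧ Wit φ r v c then φ (planeInv v h.choose) else 0

theorem dirImage_eq (hφ : Preserving φ) (h0 : ¬Adj (φ 0) r) {v : Fin 4 → ℝ} (hv : mink v v = 0)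
    {c : ℝ} (hc : c ≠ 0) (h : Wit φ r v c) : dirImage φ r v = φ (planeInv v c) := by
  have hex : ∃ c, c ≠ 0 ∧ Wit φ r v c := ⟨c, hc, h⟩
  unfold dirImage
  rw [dif_pos hex]
  exact hφ.eq_of_triangle h0 hex.choose_spec.2 h (adj_zero_planeInv hv _)
    (adj_zero_planeInv hv _) (adj_planeInv_planeInv hv _ _)

theorem dirImage_smul (hφ : Preserving φ) (h0 : ¬Adj (φ 0) r) {v : Fin 4 → ℝ}
    (hv : mink v v = 0) {c : ℝ} (hc : c ≠ 0) (h : Wit φ r v c) {k : ℝ} (hk : k ≠ 0) :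
    dirImage φ r (k • v) = dirImage φ r v := by
  rw [dirImage_eq hφ h0 hv hc h,
    dirImage_eq hφ h0 (v := k • v) (c := k * c) (by simp [mink_smul_left, mink_smul_right, hv])
      (mul_ne_zero hk hc) ((wit_smul hk v c).2 h), planeInv_smul hk]

/-- `ξ` is the inverse of an event that is mapped to `r`. -/
def InvFiber (φ : (Fin 4 → ℝ) → (Fin 4 → ℝ)) (r ξ : Fin 4 → ℝ) : Prop :=
  mink ξ ξ ≠ 0 ∧ φ (hypInv ξ) = r

theorem InvFiber.wit (hφ : Preserving φ) {a v : Fin 4 → ℝ} (ha : InvFiber φ r a)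
    (hv : mink v v = 0) (hav : mink a v ≠ 0) : Wit φ r v (mink a v) := by
  have := hφ _ _ (adj_planeInv hv ha.1 hav).symm
  rwa [ha.2] at this

/-- The propagation rule for the fiber over `r`. -/
theorem InvFiber.propagate (hφ : Preserving φ) (h0 : ¬Adj (φ 0) r) {a e v w : Fin 4 → ℝ}
    (ha : InvFiber φ r a) (he : mink e e ≠ 0) (hea : Adj e a)
    (hv : mink v v = 0) (hw : mink w w = 0) (hev : mink e v ≠ 0) (hew : mink e w ≠ 0)
    (wv : Wit φ r v (mink e v)) (ww : Wit φ r w (mink e w))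
    (hne : dirImage φ r v ≠ dirImage φ r w) : InvFiber φ r e := by
  refine ⟨he, ?_⟩
  by_contra hcon
  have h1 := hφ _ _ (adj_planeInv hv he hev)
  have h2 := hφ _ _ (adj_planeInv hw he hew)
  rw [dirImage_eq hφ h0 hv hev wv, dirImage_eq hφ h0 hw hew ww] at hne
  have h3 : Adj (φ (hypInv e)) r := by
    have := hφ _ _ (adj_hypInv he ha.1 hea)
    rwa [ha.2] at this
  have h4 := adj_of_diamond h3 hcon h1.symm wv h2.symm ww
  exact h0 (adj_of_diamond h4 hne (hφ _ _ (adj_zero_planeInv hv _))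
    (hφ _ _ (adj_zero_planeInv hw _)) wv.symm ww.symm)

/-- A frame made of two null vectors `h`, `k` and an orthonormal basis of their complement. -/
structure IsNullFrame (h k e₁ e₂ : Fin 4 → ℝ) : Prop where
  hh : mink h h = 0
  kk : mink k k = 0
  kh : mink k h = 1
  e₁h : mink e₁ h = 0
  e₁k : mink e₁ k = 0
  e₁e₁ : mink e₁ e₁ = -1
  e₂h : mink e₂ h = 0
  e₂k : mink e₂ k = 0
  e₂e₂ : mink e₂ e₂ = -1
  e₁e₂ : mink e₁ e₂ = 0
  expand : ∀ x, x = mink x k • h + mink x h • k - mink x e₁ • e₁ - mink x e₂ • e₂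

theorem eq_zero_of_sq_add_sq_add_sq {a b c : ℝ} (h : a ^ 2 + b ^ 2 + c ^ 2 = 0) :
    a = 0 ∧ b = 0 ∧ c = 0 := by
  refine ⟨?_, ?_, ?_⟩ <;> nlinarith [sq_nonneg a, sq_nonneg b, sq_nonneg c]

theorem exists_unit_orthogonal (p q s : ℝ) :
    ∃ a b c : ℝ, a ^ 2 + b ^ 2 + c ^ 2 = 1 ∧ a * p + b * q + c * s = 0 := by
  by_cases h : p ^ 2 + q ^ 2 = 0
  · have hp : p = 0 := by nlinarith [sq_nonneg p, sq_nonneg q]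
    exact ⟨1, 0, 0, by norm_num, by rw [hp]; ring⟩
  · have hpos : 0 < p ^ 2 + q ^ 2 := lt_of_le_of_ne (by positivity) (Ne.symm h)
    refine ⟨-q / √(p ^ 2 + q ^ 2), p / √(p ^ 2 + q ^ 2), 0, ?_, ?_⟩
    · rw [div_pow, div_pow, Real.sq_sqrt hpos.le]
      field_simp
      ring
    · ring

theorem exists_nullFrame {h : Fin 4 → ℝ} (hh : mink h h = 0) (h0 : h ≠ 0) :
    ∃ k e₁ e₂, IsNullFrame h k e₁ e₂ := by
  have h3 := last_ne_zero_of_null hh h0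
  obtain ⟨a, b, c, hu, ho⟩ := exists_unit_orthogonal (h 0) (h 1) (h 2)
  have hn : h 0 ^ 2 + h 1 ^ 2 + h 2 ^ 2 = h 3 ^ 2 := by unfold mink at hh; linarith
  obtain ⟨i, hi⟩ : ∃ i, i = (h 3)⁻¹ := ⟨_, rfl⟩
  have hi1 : i * h 3 = 1 := by rw [hi]; field_simp
  obtain ⟨k, hk⟩ : ∃ k : Fin 4 → ℝ, k = ![-(i ^ 2 * h 0) / 2, -(i ^ 2 * h 1) / 2,
    -(i ^ 2 * h 2) / 2, i ^ 2 * h 3 / 2] := ⟨_, rfl⟩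
  obtain ⟨e, he⟩ : ∃ e : Fin 4 → ℝ, e = ![a, b, c, 0] := ⟨_, rfl⟩
  obtain ⟨f, hf⟩ : ∃ f : Fin 4 → ℝ, f = ![i * (h 1 * c - h 2 * b), i * (h 2 * a - h 0 * c),
    i * (h 0 * b - h 1 * a), 0] := ⟨_, rfl⟩
  have hkh : mink k h = 1 := by
    simp [hk, mink]
    linear_combination i ^ 2 / 2 * hn + (i * h 3 + 1) * hi1
  have hkk : mink k k = 0 := by
    simp [hk, mink]
    linear_combination -(i ^ 4 / 4) * hn
  have heh : mink e h = 0 := by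
    simp [he, mink]; linarith
  have hek : mink e k = 0 := by
    simp [he, hk, mink]; linear_combination i ^ 2 / 2 * ho
  have hee : mink e e = -1 := by
    simp [he, mink]; linarith
  have hfh : mink f h = 0 := by
    simp [hf, mink]; ring
  have hfk : mink f k = 0 := by
    simp [hf, hk, mink]; ring
  have hff : mink f f = -1 := by
    simp [hf, mink]
    linear_combination -(i ^ 2) * (h 0 ^ 2 + h 1 ^ 2 + h 2 ^ 2) * hu - i ^ 2 * hn +
      i ^ 2 * (a * h 0 + b * h 1 + c * h 2) * ho - (i * h 3 + 1) * hi1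
  have hef : mink e f = 0 := by
    simp [he, hf, mink]; ring
  have nondeg : ∀ u : Fin 4 → ℝ, mink u k = 0 → mink u h = 0 → mink u e = 0 → mink u f = 0 →
      u = 0 := by
    intro u uk uh ue uf
    have s1 : h 0 * u 0 + h 1 * u 1 + h 2 * u 2 + h 3 * u 3 = 0 := by
      have : i ^ 2 / 2 * (h 0 * u 0 + h 1 * u 1 + h 2 * u 2 + h 3 * u 3) = 0 := by
        simp [hk, mink] at uk; linear_combination uk
      rcases mul_eq_zero.1 this with h' | h'
      · exfalso
        have hi0 : i ≠ 0 := by rw [hi]; exact inv_ne_zero h3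
        have : i ^ 2 / 2 ≠ 0 := by positivity
        exact this h'
      · exact h'
    have s2 : h 0 * u 0 + h 1 * u 1 + h 2 * u 2 - h 3 * u 3 = 0 := by
      unfold mink at uh; linear_combination -uh
    have u3 : u 3 = 0 := by
      have : h 3 * u 3 = 0 := by linarith
      simpa [h3] using this
    have s3 : h 0 * u 0 + h 1 * u 1 + h 2 * u 2 = 0 := by linarith
    have s4 : a * u 0 + b * u 1 + c * u 2 = 0 := by
      simp [he, mink] at ue; linear_combination -ue
    have s5 : (h 1 * c - h 2 * b) * u 0 + (h 2 * a - h 0 * c) * u 1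
        + (h 0 * b - h 1 * a) * u 2 = 0 := by
      simp [hf, mink] at uf
      linear_combination -(h 3) * uf - hi1 * ((h 1 * c - h 2 * b) * u 0
        + (h 2 * a - h 0 * c) * u 1 + (h 0 * b - h 1 * a) * u 2)
    have s6 : (u 0 ^ 2 + u 1 ^ 2 + u 2 ^ 2) * h 3 ^ 2 = 0 := by
      have gram : (u 0 ^ 2 + u 1 ^ 2 + u 2 ^ 2) * (h 0 ^ 2 + h 1 ^ 2 + h 2 ^ 2)
            * (a ^ 2 + b ^ 2 + c ^ 2) =
          ((h 1 * c - h 2 * b) * u 0 + (h 2 * a - h 0 * c) * u 1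
            + (h 0 * b - h 1 * a) * u 2) ^ 2
          + (u 0 ^ 2 + u 1 ^ 2 + u 2 ^ 2) * (a * h 0 + b * h 1 + c * h 2) ^ 2
          + (h 0 ^ 2 + h 1 ^ 2 + h 2 ^ 2) * (a * u 0 + b * u 1 + c * u 2) ^ 2
          + (a ^ 2 + b ^ 2 + c ^ 2) * (h 0 * u 0 + h 1 * u 1 + h 2 * u 2) ^ 2
          - 2 * (a * h 0 + b * h 1 + c * h 2) * (a * u 0 + b * u 1 + c * u 2)
            * (h 0 * u 0 + h 1 * u 1 + h 2 * u 2) := by ring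
      rw [s3, s4, s5, ho, hu, hn] at gram
      linear_combination gram
    have s7 : u 0 ^ 2 + u 1 ^ 2 + u 2 ^ 2 = 0 := by
      simpa [h3] using s6
    obtain ⟨u0, u1, u2⟩ := eq_zero_of_sq_add_sq_add_sq s7
    ext j
    fin_cases j
    exacts [u0, u1, u2, u3]
  refine ⟨k, e, f, hh, hkk, hkh, heh, hek, hee, hfh, hfk, hff, hef, fun x => ?_⟩
  rw [← sub_eq_zero]
  apply nondeg <;>
    simp only [mink_sub_left, mink_add_left, mink_smul_left, hh, hkh, hkk, heh, hek, hee, hfh,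
      hfk, hff, hef, mink_comm h k, mink_comm f e, mink_comm h e, mink_comm k e, mink_comm h f,
      mink_comm k f] <;> ring

/-- The null vectors `v` with `⟨v, h⟩ = 1`, parametrized by the plane. -/
def nullAt (h k e₁ e₂ : Fin 4 → ℝ) (z : ℝ × ℝ) : Fin 4 → ℝ :=
  k + z.1 • e₁ + z.2 • e₂ + ((z.1 ^ 2 + z.2 ^ 2) / 2) • h

namespace IsNullFrame

variable {h k e₁ e₂ : Fin 4 → ℝ}

theorem neg (F : IsNullFrame h k e₁ e₂) : IsNullFrame (-h) (-k) (-e₁) (-e₂) where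
  hh := by simp only [mink_neg_left, mink_neg_right, F.hh, neg_zero]
  kk := by simp only [mink_neg_left, mink_neg_right, F.kk, neg_zero]
  kh := by simp only [mink_neg_left, mink_neg_right, F.kh, neg_neg]
  e₁h := by simp only [mink_neg_left, mink_neg_right, F.e₁h, neg_zero]
  e₁k := by simp only [mink_neg_left, mink_neg_right, F.e₁k, neg_zero]
  e₁e₁ := by simp only [mink_neg_left, mink_neg_right, F.e₁e₁, neg_neg]
  e₂h := by simp only [mink_neg_left, mink_neg_right, F.e₂h, neg_zero]
  e₂k := by simp only [mink_neg_left, mink_neg_right, F.e₂k, neg_zero]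
  e₂e₂ := by simp only [mink_neg_left, mink_neg_right, F.e₂e₂, neg_neg]
  e₁e₂ := by simp only [mink_neg_left, mink_neg_right, F.e₁e₂, neg_zero]
  expand x := by
    simp only [mink_neg_right, smul_neg, neg_smul, neg_neg]
    exact F.expand x

theorem hk (F : IsNullFrame h k e₁ e₂) : mink h k = 1 := by rw [mink_comm, F.kh]
theorem he₁ (F : IsNullFrame h k e₁ e₂) : mink h e₁ = 0 := by rw [mink_comm, F.e₁h]
theorem he₂ (F : IsNullFrame h k e₁ e₂) : mink h e₂ = 0 := by rw [mink_comm, F.e₂h]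
theorem ke₁ (F : IsNullFrame h k e₁ e₂) : mink k e₁ = 0 := by rw [mink_comm, F.e₁k]
theorem ke₂ (F : IsNullFrame h k e₁ e₂) : mink k e₂ = 0 := by rw [mink_comm, F.e₂k]
theorem e₂e₁ (F : IsNullFrame h k e₁ e₂) : mink e₂ e₁ = 0 := by rw [mink_comm, F.e₁e₂]

theorem mink_nullAt_nullAt (F : IsNullFrame h k e₁ e₂) (z w : ℝ × ℝ) :
    mink (nullAt h k e₁ e₂ z) (nullAt h k e₁ e₂ w) =
      ((z.1 - w.1) ^ 2 + (z.2 - w.2) ^ 2) / 2 := by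
  unfold nullAt
  simp only [mink_add_left, mink_add_right, mink_smul_left, mink_smul_right, F.hh, F.kk, F.kh,
    F.e₁h, F.e₁k, F.e₁e₁, F.e₂h, F.e₂k, F.e₂e₂, F.e₁e₂, F.hk, F.he₁, F.he₂, F.ke₁, F.ke₂, F.e₂e₁]
  ring

theorem nullAt_null (F : IsNullFrame h k e₁ e₂) (z : ℝ × ℝ) :
    mink (nullAt h k e₁ e₂ z) (nullAt h k e₁ e₂ z) = 0 := by
  rw [F.mink_nullAt_nullAt]; ring

theorem mink_nullAt_h (F : IsNullFrame h k e₁ e₂) (z : ℝ × ℝ) :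
    mink (nullAt h k e₁ e₂ z) h = 1 := by
  unfold nullAt
  simp only [mink_add_left, mink_smul_left, F.hh, F.kh, F.e₁h, F.e₂h]
  ring

theorem mink_nullAt (x : Fin 4 → ℝ) (z : ℝ × ℝ) :
    mink x (nullAt h k e₁ e₂ z) = circ (mink x k) (mink x e₁) (mink x e₂) (mink x h) z.1 z.2 := by
  unfold nullAt circ
  simp only [mink_add_right, mink_smul_right]
  ring

theorem mink_self (F : IsNullFrame h k e₁ e₂) (x : Fin 4 → ℝ) :
    mink x x = 2 * mink x k * mink x h - mink x e₁ ^ 2 - mink x e₂ ^ 2 := by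
  conv_lhs => rw [F.expand x]
  simp only [mink_sub_left, mink_sub_right, mink_add_left, mink_add_right, mink_smul_left,
    mink_smul_right, F.hh, F.kk, F.kh,
    F.e₁h, F.e₁k, F.e₁e₁, F.e₂h, F.e₂k, F.e₂e₂, F.e₁e₂, F.hk, F.he₁, F.he₂, F.ke₁, F.ke₂, F.e₂e₁]
  ring

theorem exists_nullAt_eq (F : IsNullFrame h k e₁ e₂) {v : Fin 4 → ℝ} (hv : mink v v = 0)
    (hvh : mink v h = 1) : ∃ z, nullAt h k e₁ e₂ z = v := by
  refine ⟨(-mink v e₁, -mink v e₂), ?_⟩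
  have h1 := F.mink_self v
  rw [hv, hvh] at h1
  have h2 : mink v k = ((-mink v e₁) ^ 2 + (-mink v e₂) ^ 2) / 2 := by linarith
  conv_rhs => rw [F.expand v, hvh, h2]
  unfold nullAt
  simp only [neg_smul, one_smul]
  abel

end IsNullFrame

/-- Apart from one null line, the events lightlike to `s` whose images lie on the cone of `r`
have a single image. -/
def Concentrated (φ : (Fin 4 → ℝ) → (Fin 4 → ℝ)) (r s m n : Fin 4 → ℝ) : Prop :=
  mink n n = 0 ∧ n ≠ 0 ∧
    ∀ x, Adj x s → Adj (φ x) r → (∀ t : ℝ, x ≠ s + t • n) → φ x = m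

/-- If the fiber over `r` cannot be propagated to arbitrarily far hyperplanes `⟨·, h⟩ = c`, then
`dirImage` is locally constant. -/
theorem dirImage_eventually_eq (hφ : Preserving φ) (h0 : ¬Adj (φ 0) r)
    {a h k e₁ e₂ : Fin 4 → ℝ} (F : IsNullFrame h k e₁ e₂) (ha : InvFiber φ r a)
    (hb : InvFiber φ r (a + h))
    (hfar : ¬∀ᶠ c in Filter.atTop, ∃ e, InvFiber φ r e ∧ mink e h = c) (p : ℝ × ℝ)
    (hp : mink (a + h) (nullAt h k e₁ e₂ p) ≠ 0) :
    ∀ᶠ z in nhds p, dirImage φ r (nullAt h k e₁ e₂ z) = dirImage φ r (nullAt h k e₁ e₂ p) := by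
  have hself := F.mink_self a
  refine eventually_eq_of_small_steps (D := fun z => dirImage φ r (nullAt h k e₁ e₂ z))
    (G := fun z => mink (a + h) (nullAt h k e₁ e₂ z)) (A := mink a k) (B := mink a e₁)
    (C := mink a e₂) (H := mink a h) ?_ (by rw [← hself]; exact ha.1) hp ?_
  · simp only [IsNullFrame.mink_nullAt, circ]
    fun_prop
  · intro ε hε
    rw [Filter.not_eventually, Filter.frequently_atTop] at hfar
    obtain ⟨c, hc, hno⟩ := hfar (mink a h + 2 / ε ^ 2 + 1)
    obtain ⟨l, hl⟩ : ∃ l, l = c - mink a h := ⟨_, rfl⟩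
    have hl1 : 2 / ε ^ 2 < l := by rw [hl]; linarith
    have hl0 : 0 < l := lt_trans (by positivity) hl1
    have hd2 : √(2 / l) ^ 2 = 2 / l := Real.sq_sqrt (by positivity)
    refine ⟨√(2 / l), by positivity, ?_, ?_⟩
    · rw [Real.sqrt_lt' hε, div_lt_iff₀ hl0]
      rw [div_lt_iff₀ (by positivity)] at hl1
      linarith
    · intro x y x' y' hdist h1 h2 h3
      by_contra hne
      rw [hd2] at hdist h3
      rw [← hself] at h3
      obtain ⟨v, hv⟩ : ∃ v, v = nullAt h k e₁ e₂ (x, y) := ⟨_, rfl⟩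
      obtain ⟨w, hw⟩ : ∃ w, w = nullAt h k e₁ e₂ (x', y') := ⟨_, rfl⟩
      have hvw : mink w v = 1 / l := by
        rw [hv, hw, mink_comm, F.mink_nullAt_nullAt]
        simp only
        rw [hdist]; ring
      have hvv : mink v v = 0 := by rw [hv]; exact F.nullAt_null _
      have hww : mink w w = 0 := by rw [hw]; exact F.nullAt_null _
      have hvh : mink v h = 1 := by rw [hv]; exact F.mink_nullAt_h _
      have hwh : mink w h = 1 := by rw [hw]; exact F.mink_nullAt_h _
      have haw : mink a w = circ (mink a k) (mink a e₁) (mink a e₂) (mink a h) x' y' := by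
        rw [hw]; exact IsNullFrame.mink_nullAt _ _
      rw [← haw] at h2 h3
      simp only [← hv, ← hw] at hne h1
      have eh : mink (a + l • w) h = c := by
        rw [mink_add_left, mink_smul_left, hwh, hl]; ring
      have ev : mink (a + l • w) v = mink (a + h) v := by
        rw [mink_add_left, mink_smul_left, hvw, mink_add_left, mink_comm h v, hvh]
        field_simp
      have ew : mink (a + l • w) w = mink a w := by
        rw [mink_add_left, mink_smul_left, hww]; ring
      have ee : mink (a + l • w) (a + l • w) = l / 2 * (mink a a * (2 / l) + 4 * mink a w) := by
        simp only [mink_add_left, mink_add_right, mink_smul_left, mink_smul_right, hww,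
          mink_comm w a]
        field_simp
        ring
      refine hno ⟨a + l • w, ?_, eh⟩
      refine ha.propagate hφ h0 ?_ (adj_add_smul_self hww _) hvv hww ?_ ?_ ?_ ?_ hne
      · rw [ee]; exact mul_ne_zero (by positivity) h3
      · rwa [ev]
      · rwa [ew]
      · rw [ev]; exact hb.wit hφ hvv h1
      · rw [ew]; exact ha.wit hφ hww h2

theorem exists_dirImage_ne (hφ : Preserving φ) (h0 : ¬Adj (φ 0) r)
    (hK : ∀ m n, ¬Concentrated φ r 0 m n) {n : Fin 4 → ℝ} (hn : mink n n = 0) (hn0 : n ≠ 0)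
    (m : Fin 4 → ℝ) :
    ∃ f, mink f f = 0 ∧ mink f n ≠ 0 ∧ Wit φ r f (1 / 2) ∧ dirImage φ r f ≠ m := by
  have := hK m n
  unfold Concentrated at this
  push Not at this
  obtain ⟨f, f0, fr, fn, fm⟩ := this hn hn0
  have ff : mink f f = 0 := by simpa [Adj] using f0
  have hw : Wit φ r f (1 / 2) := by unfold Wit; rwa [planeInv_half]
  refine ⟨f, ff, ?_, hw, ?_⟩
  · intro hfn
    obtain ⟨t, ht⟩ := null_parallel_of_orthogonal hn hn0 ff (by rwa [mink_comm])
    exact fn t (by rw [ht]; simp)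
  · rw [dirImage_eq hφ h0 ff (by norm_num) hw, planeInv_half]
    exact fm

/-- The fiber over `r` reaches all far hyperplanes `⟨·, h⟩ = c` on one side. -/
theorem eventually_reach (hφ : Preserving φ) (h0 : ¬Adj (φ 0) r)
    (hK : ∀ m n, ¬Concentrated φ r 0 m n) {a h : Fin 4 → ℝ} (hh : mink h h = 0) (hh0 : h ≠ 0)
    (ha : InvFiber φ r a) (hb : InvFiber φ r (a + h)) :
    (∀ᶠ c in Filter.atTop, ∃ e, InvFiber φ r e ∧ mink e h = c) ∨
    (∀ᶠ c in Filter.atTop, ∃ e, InvFiber φ r e ∧ mink e (-h) = c) := by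
  by_contra hcon
  rw [not_or] at hcon
  obtain ⟨far₁, far₂⟩ := hcon
  obtain ⟨k, e₁, e₂, F⟩ := exists_nullFrame hh hh0
  have hgap : ∀ z, mink (a + h) (nullAt h k e₁ e₂ z) = mink a (nullAt h k e₁ e₂ z) + 1 := by
    intro z
    rw [mink_add_left, mink_comm h, F.mink_nullAt_h]
  have hneg : ∀ z, nullAt (-h) (-k) (-e₁) (-e₂) z = (-1 : ℝ) • nullAt h k e₁ e₂ z := by
    intro z
    unfold nullAt
    module
  have hdneg : ∀ z, dirImage φ r (nullAt (-h) (-k) (-e₁) (-e₂) z)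
      = dirImage φ r (nullAt h k e₁ e₂ z) := by
    intro z
    rw [hneg]
    by_cases haz : mink a (nullAt h k e₁ e₂ z) = 0
    · have hbz : mink (a + h) (nullAt h k e₁ e₂ z) ≠ 0 := by rw [hgap, haz]; norm_num
      exact dirImage_smul hφ h0 (F.nullAt_null z) hbz (hb.wit hφ (F.nullAt_null z) hbz)
        (by norm_num)
    · exact dirImage_smul hφ h0 (F.nullAt_null z) haz (ha.wit hφ (F.nullAt_null z) haz)
        (by norm_num)
  have hloc : IsLocallyConstant fun z => dirImage φ r (nullAt h k e₁ e₂ z) := by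
    rw [IsLocallyConstant.iff_eventually_eq]
    intro p
    by_cases hbp : mink (a + h) (nullAt h k e₁ e₂ p) = 0
    · have := dirImage_eventually_eq hφ h0 F.neg (a := a + h) hb (by simpa using ha) far₂ p
        (by
          rw [add_neg_cancel_right, hneg, mink_smul_right]
          rw [hgap] at hbp
          intro h'
          linarith)
      simpa only [hdneg] using this
    · exact dirImage_eventually_eq hφ h0 F ha hb far₁ p hbp
  obtain ⟨f, ff, fh, fw, fne⟩ := exists_dirImage_ne hφ h0 hK hh hh0
    (dirImage φ r (nullAt h k e₁ e₂ (0, 0)))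
  obtain ⟨z, hz⟩ := F.exists_nullAt_eq (v := (mink f h)⁻¹ • f)
    (by rw [mink_smul_left, mink_smul_right, ff]; ring)
    (by rw [mink_smul_left, inv_mul_cancel₀ fh])
  apply fne
  rw [← dirImage_smul hφ h0 ff (by norm_num) fw (inv_ne_zero fh), ← hz]
  exact hloc.apply_eq_of_preconnectedSpace z (0, 0)

/-- `w` is a null vector in the same half of the light cone as `h`. -/
def SameSide (h w : Fin 4 → ℝ) : Prop := mink w w = 0 ∧ 0 < w 3 * h 3

theorem SameSide.ne_zero {h w : Fin 4 → ℝ} (hw : SameSide h w) : w ≠ 0 := by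
  rintro rfl
  simpa using hw.2

theorem SameSide.mink_pos {h v w : Fin 4 → ℝ} (hv : SameSide h v) (hw : SameSide h w)
    (hne : mink v w ≠ 0) : 0 < mink v w := by
  refine lt_of_le_of_ne (mink_nonneg_of_null hv.1 hw.1 ?_) hne.symm
  have h1 := mul_pos hv.2 hw.2
  by_contra hneg
  nlinarith [sq_nonneg (h 3)]

theorem sameSide_or {h w : Fin 4 → ℝ} (hh : mink h h = 0) (hh0 : h ≠ 0) (hw : mink w w = 0)
    (hw0 : w ≠ 0) : ∃ k : ℝ, (k = 1 ∨ k = -1) ∧ SameSide h (k • w) := by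
  have h1 := mul_ne_zero (last_ne_zero_of_null hw hw0) (last_ne_zero_of_null hh hh0)
  rcases lt_or_gt_of_ne h1 with h2 | h2
  · exact ⟨-1, Or.inr rfl, by rw [mink_smul_left, mink_smul_right, hw]; ring, by
      rw [Pi.smul_apply, smul_eq_mul]; linarith⟩
  · exact ⟨1, Or.inl rfl, by rwa [one_smul], by rwa [one_smul]⟩

/-- The fiber over `r` meets every far hyperplane `⟨·, w⟩ = c`. -/
def Reaches (φ : (Fin 4 → ℝ) → (Fin 4 → ℝ)) (r w : Fin 4 → ℝ) : Prop :=
  ∀ᶠ c in Filter.atTop, ∃ e, InvFiber φ r e ∧ mink e w = c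

theorem tendsto_affine_atTop (x : ℝ) {y : ℝ} (hy : 0 < y) :
    Filter.Tendsto (fun t : ℝ => x + t * y) Filter.atTop Filter.atTop :=
  Filter.tendsto_atTop_add_const_left _ _ (Filter.tendsto_id.atTop_mul_const hy)

theorem eventually_affine_ne_zero (x : ℝ) {y : ℝ} (hy : y ≠ 0) :
    ∀ᶠ t : ℝ in Filter.atTop, x + t * y ≠ 0 := by
  filter_upwards [Filter.eventually_gt_atTop (-x / y)] with t ht h
  have : t = -x / y := by field_simp; linarith
  exact ht.ne' this

theorem Reaches.wit (hφ : Preserving φ) {w : Fin 4 → ℝ} (hw : mink w w = 0)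
    (h : Reaches φ r w) : ∀ᶠ c in Filter.atTop, c ≠ 0 ∧ Wit φ r w c := by
  filter_upwards [h, Filter.eventually_ne_atTop 0] with c ⟨e, he, hec⟩ hc
  refine ⟨hc, ?_⟩
  rw [← hec]
  exact he.wit hφ hw (by rwa [hec])

theorem Reaches.eventually_invFiber (hφ : Preserving φ) (h0 : ¬Adj (φ 0) r)
    {a v w : Fin 4 → ℝ} (hv : mink v v = 0) (hw : mink w w = 0) (hwv : 0 < mink w v)
    (hne : dirImage φ r v ≠ dirImage φ r w) (hR : Reaches φ r v) (ha : InvFiber φ r a)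
    (haw : mink a w ≠ 0) : ∀ᶠ t : ℝ in Filter.atTop, InvFiber φ r (a + t • w) := by
  filter_upwards [(tendsto_affine_atTop (mink a v) hwv).eventually (hR.wit hφ hv),
    eventually_affine_ne_zero (mink a a) (mul_ne_zero two_ne_zero haw)] with t h1 h2
  have ev : mink (a + t • w) v = mink a v + t * mink w v := by
    rw [mink_add_left, mink_smul_left]
  have ew : mink (a + t • w) w = mink a w := by
    rw [mink_add_left, mink_smul_left, hw]; ring
  have ee : mink (a + t • w) (a + t • w) = mink a a + t * (2 * mink a w) := by
    simp only [mink_add_left, mink_add_right, mink_smul_left, mink_smul_right, hw, mink_comm w a]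
    ring
  rw [← ev] at h1
  refine ha.propagate hφ h0 ?_ (adj_add_smul_self hw _) hv hw h1.1 ?_ h1.2 ?_ hne
  · rwa [ee]
  · rwa [ew]
  · rw [ew]; exact ha.wit hφ hw haw

theorem reaches_of_eventually_invFiber {a v w : Fin 4 → ℝ} (hvw : 0 < mink v w)
    (h : ∀ᶠ t : ℝ in Filter.atTop, InvFiber φ r (a + t • v)) : Reaches φ r w := by
  have lim : Filter.Tendsto (fun c : ℝ => -mink a w / mink v w + c * (1 / mink v w))
      Filter.atTop Filter.atTop := tendsto_affine_atTop _ (by positivity)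
  filter_upwards [lim.eventually h] with c hc
  refine ⟨_, hc, ?_⟩
  rw [mink_add_left, mink_smul_left]
  field_simp
  ring

theorem exists_sameSide_dirImage_ne (hφ : Preserving φ) (h0 : ¬Adj (φ 0) r)
    (hK : ∀ m n, ¬Concentrated φ r 0 m n) {h n : Fin 4 → ℝ} (hh : mink h h = 0) (hh0 : h ≠ 0)
    (hn : mink n n = 0) (hn0 : n ≠ 0) (m : Fin 4 → ℝ) :
    ∃ v c, SameSide h v ∧ mink v n ≠ 0 ∧ c ≠ 0 ∧ Wit φ r v c ∧ dirImage φ r v ≠ m := by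
  obtain ⟨f, ff, fn, fw, fm⟩ := exists_dirImage_ne hφ h0 hK hn hn0 m
  obtain ⟨k, hk, hs⟩ := sameSide_or hh hh0 ff (ne_zero_of_mink_ne_zero fn)
  have hk0 : k ≠ 0 := by rcases hk with rfl | rfl <;> norm_num
  refine ⟨k • f, k * (1 / 2), hs, ?_, by simpa using hk0, (wit_smul hk0 _ _).2 fw, ?_⟩
  · rw [mink_smul_left]; exact mul_ne_zero hk0 fn
  · rwa [dirImage_smul hφ h0 ff (by norm_num) fw hk0]

theorem Reaches.sameSide (hφ : Preserving φ) (h0 : ¬Adj (φ 0) r)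
    (hK : ∀ m n, ¬Concentrated φ r 0 m n) {a h w : Fin 4 → ℝ} (hh : mink h h = 0) (hh0 : h ≠ 0)
    (ha : InvFiber φ r a) (hb : InvFiber φ r (a + h)) (hR : Reaches φ r h) (hw : SameSide h w) :
    Reaches φ r w := by
  obtain ⟨v, c, hv, hvw, hc, hvc, hne⟩ := exists_sameSide_dirImage_ne hφ h0 hK hh hh0 hw.1
    hw.ne_zero (dirImage φ r h)
  have hvh : mink v h ≠ 0 := by
    intro hvh
    obtain ⟨t, rfl⟩ := null_parallel_of_orthogonal hv.1 hv.ne_zero hh hvh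
    have ht : t ≠ 0 := by
      rintro rfl
      simp at hh0
    exact hne (dirImage_smul hφ h0 hv.1 hc hvc ht).symm
  have hside : SameSide h h :=
    ⟨hh, mul_self_pos.2 (last_ne_zero_of_null hh hh0)⟩
  obtain ⟨b, hb', hbv⟩ : ∃ b, InvFiber φ r b ∧ mink b v ≠ 0 := by
    by_cases hav : mink a v = 0
    · refine ⟨a + h, hb, ?_⟩
      rw [mink_add_left, hav, zero_add, mink_comm]
      exact hvh
    · exact ⟨a, ha, hav⟩
  exact reaches_of_eventually_invFiber (hv.mink_pos hw hvw)
    (hR.eventually_invFiber hφ h0 hh hv.1 (hv.mink_pos hside hvh) hne.symm hb' hbv)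

/-- Every null event other than the origin is mapped to the cone of `r`. -/
theorem wit_of_reaches (hφ : Preserving φ) (h0 : ¬Adj (φ 0) r)
    (hK : ∀ m n, ¬Concentrated φ r 0 m n) {h w : Fin 4 → ℝ} (hh : mink h h = 0) (hh0 : h ≠ 0)
    (hR : ∀ w, SameSide h w → Reaches φ r w) (hw : SameSide h w) {τ : ℝ} (hτ : τ ≠ 0) :
    Wit φ r w τ := by
  obtain ⟨v, -, hv, hvw, -, -, -⟩ := exists_sameSide_dirImage_ne hφ h0 hK hh hh0 hw.1
    hw.ne_zero 0
  obtain ⟨u, -, hu, huw, -, -, hne⟩ := exists_sameSide_dirImage_ne hφ h0 hK hh hh0 hw.1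
    hw.ne_zero (dirImage φ r v)
  obtain ⟨_, haw, a, ha, rfl⟩ := ((Filter.eventually_ne_atTop (0 : ℝ)).and (hR w hw)).exists
  have hline : ∀ᶠ t : ℝ in Filter.atTop, InvFiber φ r (a + t • w) := by
    by_cases hvw' : dirImage φ r v = dirImage φ r w
    · refine (hR u hu).eventually_invFiber hφ h0 hu.1 hw.1 ?_ (by rwa [← hvw']) ha haw
      rw [mink_comm]; exact hu.mink_pos hw huw
    · refine (hR v hv).eventually_invFiber hφ h0 hv.1 hw.1 ?_ hvw' ha haw
      rw [mink_comm]; exact hv.mink_pos hw hvw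
  obtain ⟨μ, hμ⟩ : ∃ μ, μ = (τ - mink a w) / mink v w := ⟨_, rfl⟩
  have hμ' : μ * mink v w = τ - mink a w := by rw [hμ]; field_simp
  have huw0 := hu.mink_pos hw huw
  rw [mink_comm] at huw0
  have hvw0 := hv.mink_pos hw hvw
  obtain ⟨t, h1, h2, h3, h4⟩ := (hline.and
    (((tendsto_affine_atTop (mink a u + μ * mink v u) huw0).eventually
      ((hR u hu).wit hφ hu.1)).and
    ((eventually_affine_ne_zero (mink a v) hvw).and
    (eventually_affine_ne_zero (mink a a + 2 * μ * mink a v)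
      (mul_ne_zero two_ne_zero hτ))))).exists
  have ew : mink (a + t • w + μ • v) w = τ := by
    simp only [mink_add_left, mink_smul_left, hw.1]
    linarith
  have eu : mink (a + t • w + μ • v) u = mink a u + μ * mink v u + t * mink w u := by
    simp only [mink_add_left, mink_smul_left]; ring
  have ev : mink (a + t • w + μ • v) v = mink (a + t • w) v := by
    rw [mink_add_left, mink_smul_left, hv.1]; ring
  have ev' : mink (a + t • w) v = mink a v + t * mink v w := by
    rw [mink_add_left, mink_smul_left, mink_comm v w]
  have ee : mink (a + t • w + μ • v) (a + t • w + μ • v)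
      = mink a a + 2 * μ * mink a v + t * (2 * τ) := by
    simp only [mink_add_left, mink_add_right, mink_smul_left, mink_smul_right, hw.1, hv.1,
      mink_comm w a, mink_comm v a, mink_comm w v]
    linear_combination 2 * t * hμ'
  rw [← ev'] at h3
  rw [← eu] at h2
  have key : InvFiber φ r (a + t • w + μ • v) := by
    refine h1.propagate hφ h0 (by rwa [ee]) (adj_add_smul_self hv.1 _) hu.1 hv.1 h2.1
      (by rwa [ev]) h2.2 ?_ hne
    rw [ev]
    exact h1.wit hφ hv.1 h3
  have := key.wit hφ hw.1 (by rwa [ew])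
  rwa [ew] at this

/-- If the fiber over `r` contains two lightlike events and the cone at `0` is not concentrated,
then the whole space without the origin is mapped to the cone of `r`. -/
theorem adj_of_not_concentrated_zero (hφ : Preserving φ) (h0 : ¬Adj (φ 0) r)
    (hK : ∀ m n, ¬Concentrated φ r 0 m n) {p q : Fin 4 → ℝ} (hpq : Adj p q) (hne : p ≠ q)
    (hp : φ p = r) (hq : φ q = r) (x : Fin 4 → ℝ) (hx : x ≠ 0) : Adj (φ x) r := by
  have nonnull : ∀ y, φ y = r → mink y y ≠ 0 := by
    intro y hy hyy
    apply h0
    rw [← hy]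
    apply hφ
    apply Adj.symm
    simpa [Adj] using hyy
  have hinv : ∀ y, φ y = r → InvFiber φ r (hypInv y) := fun y hy =>
    ⟨by rw [mink_hypInv]; exact inv_ne_zero (nonnull y hy), by
      rw [hypInv_hypInv (nonnull y hy)]; exact hy⟩
  obtain ⟨a, h, ha, hb, hh, hh0, hR⟩ : ∃ a h, InvFiber φ r a ∧ InvFiber φ r (a + h) ∧
      mink h h = 0 ∧ h ≠ 0 ∧ Reaches φ r h := by
    have ha := hinv p hp
    have hb := hinv q hq
    have hadj := adj_hypInv (nonnull q hq) (nonnull p hp) hpq.symm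
    have hd : hypInv q - hypInv p ≠ 0 := by
      intro h
      apply hne
      rw [← hypInv_hypInv (nonnull p hp), ← hypInv_hypInv (nonnull q hq), sub_eq_zero.1 h]
    rcases eventually_reach hφ h0 hK (a := hypInv p) (h := hypInv q - hypInv p) hadj hd ha
      (by simpa using hb) with h | h
    · exact ⟨_, _, ha, by simpa using hb, hadj, hd, h⟩
    · exact ⟨hypInv q, -(hypInv q - hypInv p), hb, by simpa using ha,
        by rwa [mink_neg_left, mink_neg_right, neg_neg], neg_ne_zero.2 hd, h⟩
  have wit : ∀ w, mink w w = 0 → w ≠ 0 → ∀ τ : ℝ, τ ≠ 0 → Wit φ r w τ := by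
    intro w hw hw0 τ hτ
    obtain ⟨k, hk, hs⟩ := sameSide_or hh hh0 hw hw0
    have hk0 : k ≠ 0 := by rcases hk with rfl | rfl <;> norm_num
    rw [← wit_smul hk0]
    exact wit_of_reaches hφ h0 hK hh hh0
      (fun w hw => hR.sameSide hφ h0 hK hh hh0 ha hb hw) hs (mul_ne_zero hk0 hτ)
  by_cases hxx : mink x x = 0
  · have := wit x hxx hx (1 / 2) (by norm_num)
    unfold Wit at this
    rwa [planeInv_half] at this
  obtain ⟨ξ, hξ⟩ : ∃ ξ, ξ = hypInv x := ⟨_, rfl⟩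
  have hξξ : mink ξ ξ ≠ 0 := by rw [hξ, mink_hypInv]; exact inv_ne_zero hxx
  have hξx : hypInv ξ = x := by rw [hξ, hypInv_hypInv hxx]
  have conclude : ∀ e, InvFiber φ r e → Adj ξ e → Adj (φ x) r := by
    intro e he hadj
    have := hφ _ _ (adj_hypInv hξξ he.1 hadj)
    rwa [hξx, he.2] at this
  by_cases haξ : mink (a - ξ) (a - ξ) = 0
  · exact conclude a ha (Adj.symm haξ)
  have ha0 : a ≠ 0 := ne_zero_of_mink_ne_zero ha.1
  have haξ0 : a - ξ ≠ 0 := ne_zero_of_mink_ne_zero haξ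
  obtain ⟨w₁, w₁w₁, w₁h, -, -⟩ := exists_dirImage_ne hφ h0 hK hh hh0 0
  obtain ⟨w₂, w₂w₂, w₂h, -, hw₁₂⟩ := exists_dirImage_ne hφ h0 hK hh hh0 (dirImage φ r w₁)
  have hw₁0 := ne_zero_of_mink_ne_zero w₁h
  have hw₂0 := ne_zero_of_mink_ne_zero w₂h
  have gen₁ : mink a a • (a - ξ) - mink (a - ξ) (a - ξ) • a ≠ 0 := by
    intro h
    rw [sub_eq_zero] at h
    have i1 := congrArg (fun y => mink y (a - ξ)) h
    have i2 := congrArg (fun y => mink y a) h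
    simp only [mink_smul_left] at i1 i2
    have i3 : mink a a = mink a (a - ξ) :=
      mul_left_cancel₀ haξ (by linarith)
    have i4 : mink (a - ξ) (a - ξ) = mink (a - ξ) a := mul_left_cancel₀ ha.1 (by linarith)
    apply hξξ
    simp only [mink_sub_left, mink_sub_right] at i3 i4
    linarith [mink_comm a ξ]
  have gen₂ : ∀ w, mink w w = 0 → w ≠ 0 →
      (2 * mink a w) • (a - ξ) - mink (a - ξ) (a - ξ) • w ≠ 0 := by
    intro w hw hw0 h
    rw [sub_eq_zero] at h
    have i1 := congrArg (fun y => mink y y) h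
    simp only [mink_smul_left, mink_smul_right, hw] at i1
    have i2 : mink a w = 0 := by
      by_contra i2
      have : 2 * mink a w * (2 * mink a w * mink (a - ξ) (a - ξ)) ≠ 0 := by
        simp [i2, haξ]
      exact this (by simpa using i1)
    rw [i2] at h
    simp only [mul_zero, zero_smul] at h
    rcases smul_eq_zero.1 h.symm with h' | h'
    · exact haξ h'
    · exact hw0 h'
  obtain ⟨v, vv, v0, hv⟩ := exists_null_generic
    [a, a - ξ, mink a a • (a - ξ) - mink (a - ξ) (a - ξ) • a,
      (2 * mink a w₁) • (a - ξ) - mink (a - ξ) (a - ξ) • w₁,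
      (2 * mink a w₂) • (a - ξ) - mink (a - ξ) (a - ξ) • w₂]
    (by simpa [ha0, haξ0, gen₁] using ⟨gen₂ w₁ w₁w₁ hw₁0, gen₂ w₂ w₂w₂ hw₂0⟩)
  simp only [List.mem_cons, List.not_mem_nil, or_false, forall_eq_or_imp, forall_eq] at hv
  obtain ⟨v1, v2, v3, v4, v5⟩ := hv
  simp only [mink_sub_left, mink_smul_left] at v3 v4 v5
  simp only [← mink_sub_left] at v3 v4 v5
  obtain ⟨w, ww, hw0, hwv, hne'⟩ : ∃ w, mink w w = 0 ∧ w ≠ 0 ∧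
      2 * mink a w * mink (a - ξ) v - mink (a - ξ) (a - ξ) * mink w v ≠ 0 ∧
      dirImage φ r w ≠ dirImage φ r v := by
    by_cases h : dirImage φ r w₁ = dirImage φ r v
    · exact ⟨w₂, w₂w₂, hw₂0, v5, by rwa [← h]⟩
    · exact ⟨w₁, w₁w₁, hw₁0, v4, h⟩
  obtain ⟨l, hl⟩ : ∃ l, l = -mink (a - ξ) (a - ξ) / (2 * mink (a - ξ) v) := ⟨_, rfl⟩
  have hl' : 2 * l * mink (a - ξ) v = -mink (a - ξ) (a - ξ) := by rw [hl]; field_simp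
  have ee : mink (a + l • v) (a + l • v) * mink (a - ξ) v =
      mink a a * mink (a - ξ) v - mink (a - ξ) (a - ξ) * mink a v := by
    simp only [mink_add_left, mink_add_right, mink_smul_left, mink_smul_right, vv, mink_comm v a]
    linear_combination mink a v * hl'
  have ew : 2 * (mink (a + l • v) w * mink (a - ξ) v) =
      2 * mink a w * mink (a - ξ) v - mink (a - ξ) (a - ξ) * mink w v := by
    rw [mink_add_left, mink_smul_left, mink_comm v w]
    linear_combination mink w v * hl'
  have ev : mink (a + l • v) v = mink a v := by
    rw [mink_add_left, mink_smul_left, vv]; ring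
  have ee0 : mink (a + l • v) (a + l • v) ≠ 0 := fun h => v3 (by rw [← ee, h]; ring)
  have ew0 : mink (a + l • v) w ≠ 0 := fun h => hwv (by rw [← ew, h]; ring)
  refine conclude (a + l • v) ?_ ?_
  · exact ha.propagate hφ h0 ee0 (adj_add_smul_self vv _) ww vv ew0 (by rwa [ev])
      (wit w ww hw0 _ ew0) (wit v vv v0 _ (by rwa [ev])) hne'
  · apply Adj.symm
    unfold Adj
    rw [mink_add_smul_sub _ _ _ vv]
    linarith

theorem Preserving.adj_of_not_concentrated (hφ : Preserving φ) {p q s : Fin 4 → ℝ}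
    (hs : ¬Adj (φ s) r) (hK : ∀ m n, ¬Concentrated φ r s m n) (hpq : Adj p q) (hne : p ≠ q)
    (hp : φ p = r) (hq : φ q = r) (x : Fin 4 → ℝ) (hx : x ≠ s) : Adj (φ x) r := by
  have htr : ∀ x y : Fin 4 → ℝ, Adj (x + s) (y + s) ↔ Adj x y := by
    intro x y
    unfold Adj
    rw [add_sub_add_right_eq_sub]
  have := adj_of_not_concentrated_zero (φ := fun x => φ (x + s)) (r := r)
    (fun x y hxy => hφ _ _ ((htr x y).2 hxy)) (by simpa using hs) ?_ (p := p - s) (q := q - s)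
    ?_ ?_ (by simpa using hp) (by simpa using hq) (x - s) (sub_ne_zero.2 hx)
  · simpa using this
  · rintro m n ⟨h1, h2, h3⟩
    refine hK m n ⟨h1, h2, fun y hy hyr hyn => ?_⟩
    have := h3 (y - s) ?_ (by simpa using hyr) ?_
    · simpa using this
    · rw [← htr]; simpa using hy
    · intro t ht
      exact hyn t (by rw [← sub_add_cancel y s, ht]; abel)
  · rw [← htr]; simpa using hpq
  · simpa using hne

/-- A multiple of the reflection in `τ`. -/
def scaledRefl (τ x : Fin 4 → ℝ) : Fin 4 → ℝ := mink τ τ • x - (2 * mink τ x) • τ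

theorem mink_scaledRefl_left (τ x y : Fin 4 → ℝ) :
    mink (scaledRefl τ x) y = mink τ τ * mink x y - 2 * mink τ x * mink τ y := by
  unfold scaledRefl
  rw [mink_sub_left, mink_smul_left, mink_smul_left]

theorem mink_scaledRefl_comm (τ x y : Fin 4 → ℝ) :
    mink x (scaledRefl τ y) = mink (scaledRefl τ x) y := by
  rw [mink_comm, mink_scaledRefl_left, mink_scaledRefl_left, mink_comm y x]
  ring

theorem mink_scaledRefl_self (τ x : Fin 4 → ℝ) :
    mink (scaledRefl τ x) (scaledRefl τ x) = mink τ τ ^ 2 * mink x x := by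
  rw [mink_scaledRefl_left, mink_comm x, mink_comm τ (scaledRefl τ x), mink_scaledRefl_left,
    mink_scaledRefl_left,
    mink_comm x τ]
  ring

theorem scaledRefl_ne_zero {τ x : Fin 4 → ℝ} (hτ : mink τ τ ≠ 0) (hx : x ≠ 0) :
    scaledRefl τ x ≠ 0 := by
  intro h
  have h1 := mink_scaledRefl_left τ x τ
  rw [h, mink_zero_left, mink_comm x τ] at h1
  have h2 : mink τ x = 0 := by
    have : mink τ τ * mink τ x = 0 := by linarith
    simpa [hτ] using this
  unfold scaledRefl at h
  rw [h2] at h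
  simp [hτ, hx] at h

theorem not_mem_line_of_null {s v n : Fin 4 → ℝ} {κ : ℝ} (hκ : κ ≠ 0) (vv : mink v v = 0)
    (v0 : v ≠ 0) (hnv : mink n v ≠ 0) (t : ℝ) : s + κ • v ≠ s + t • n := by
  intro h
  have h1 : κ • v = t • n := add_left_cancel h
  have h2 := congrArg (fun y => mink y v) h1
  simp only [mink_smul_left, vv, mul_zero] at h2
  have h3 : t = 0 := by simpa [hnv] using h2.symm
  rw [h3, zero_smul] at h1
  simp [hκ, v0] at h1

/-- The parameter at which the null line through `s` with direction `v` meets the cone of `p`. -/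
def meetPar (s v p : Fin 4 → ℝ) : ℝ := mink (p - s) (p - s) / (2 * mink (p - s) v)

theorem adj_meetPar {s v p : Fin 4 → ℝ} (vv : mink v v = 0) (h : mink (p - s) v ≠ 0) :
    Adj (s + meetPar s v p • v) p := adj_meet vv h

theorem meetPar_ne_zero {s v p : Fin 4 → ℝ} (hp : ¬Adj p s) (h : mink (p - s) v ≠ 0) :
    meetPar s v p ≠ 0 := div_ne_zero hp (mul_ne_zero two_ne_zero h)

theorem meet_not_mem_line {s v p n : Fin 4 → ℝ} (nn : mink n n = 0) (h : mink (p - s) v ≠ 0)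
    (hr : mink (scaledRefl (p - s) n) v ≠ 0) (t : ℝ) : s + meetPar s v p • v ≠ p + t • n := by
  intro heq
  have h1 : meetPar s v p • v = (p - s) + t • n := by
    have : meetPar s v p • v = (s + meetPar s v p • v) - s := by abel
    rw [this, heq]; abel
  have h2 := congrArg (fun y => mink y n) h1
  simp only [mink_smul_left, mink_add_left, nn] at h2
  apply hr
  rw [mink_scaledRefl_left, mink_comm n v]
  unfold meetPar at h2
  field_simp at h2
  linarith

theorem smul_sub_smul_ne_zero {a b s : Fin 4 → ℝ} (hA : mink (a - s) (a - s) ≠ 0)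
    (hB : mink (b - s) (b - s) ≠ 0) (hne : a ≠ b) :
    mink (a - s) (a - s) • (b - s) - mink (b - s) (b - s) • (a - s) ≠ 0 := by
  intro h
  have h1 : b - s = (mink (b - s) (b - s) / mink (a - s) (a - s)) • (a - s) := by
    rw [div_eq_inv_mul, mul_smul, ← sub_eq_zero.1 h, smul_smul, inv_mul_cancel₀ hA, one_smul]
  obtain ⟨c, hc⟩ : ∃ c, c = mink (b - s) (b - s) / mink (a - s) (a - s) := ⟨_, rfl⟩
  rw [← hc] at h1
  have h2 : mink (b - s) (b - s) = c * (c * mink (a - s) (a - s)) := by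
    rw [h1, mink_smul_left, mink_smul_right]
  have h3 : mink (b - s) (b - s) = c * mink (a - s) (a - s) := by rw [hc]; field_simp
  have hc0 : c ≠ 0 := by
    rintro rfl
    exact hB (by rw [h3]; ring)
  have h4 : mink (a - s) (a - s) = c * mink (a - s) (a - s) :=
    mul_left_cancel₀ hc0 (by linarith)
  have h5 : c = 1 := mul_right_cancel₀ hA (by linarith)
  rw [h5, one_smul] at h1
  exact hne (sub_left_injective h1).symm

/-- `r` is the image of two distinct lightlike events. -/
def Fat (φ : (Fin 4 → ℝ) → (Fin 4 → ℝ)) (r : Fin 4 → ℝ) : Prop :=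
  ∃ a b, Adj a b ∧ a ≠ b ∧ φ a = r ∧ φ b = r

theorem Concentrated.apply {s m n v : Fin 4 → ℝ} (hK : Concentrated φ r s m n)
    (vv : mink v v = 0) (v0 : v ≠ 0) (hnv : mink n v ≠ 0) {κ : ℝ} (hκ : κ ≠ 0)
    (h : Adj (φ (s + κ • v)) r) : φ (s + κ • v) = m :=
  hK.2.2 _ (adj_add_smul_self vv κ) h (not_mem_line_of_null hκ vv v0 hnv)

theorem Concentrated.generic_pair (hφ : Preserving φ) {s m n : Fin 4 → ℝ} (hr : Fat φ r)
    (hs : ¬Adj (φ s) r) (hK : Concentrated φ r s m n) :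
    Adj m r ∧ ∃ l : List (Fin 4 → ℝ), (∀ u ∈ l, u ≠ 0) ∧
      ∀ v, mink v v = 0 → v ≠ 0 → (∀ u ∈ l, mink u v ≠ 0) →
        ∃ κ κ' : ℝ, κ ≠ 0 ∧ κ ≠ κ' ∧ φ (s + κ • v) = m ∧ φ (s + κ' • v) = m := by
  obtain ⟨a, b, hab, hne, ha, hb⟩ := hr
  have hsa : ¬Adj a s := fun h => hs (by rw [← ha]; exact hφ _ _ h.symm)
  have hsb : ¬Adj b s := fun h => hs (by rw [← hb]; exact hφ _ _ h.symm)
  have hA : mink (a - s) (a - s) ≠ 0 := hsa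
  have hB : mink (b - s) (b - s) ≠ 0 := hsb
  have key : ∀ v, mink v v = 0 → v ≠ 0 → (∀ u ∈ [a - s, b - s, n,
      mink (a - s) (a - s) • (b - s) - mink (b - s) (b - s) • (a - s)], mink u v ≠ 0) →
      meetPar s v a ≠ 0 ∧ meetPar s v a ≠ meetPar s v b ∧ φ (s + meetPar s v a • v) = m ∧
        φ (s + meetPar s v b • v) = m := by
    intro v vv v0 hv
    simp only [List.mem_cons, List.not_mem_nil, or_false, forall_eq_or_imp, forall_eq] at hv
    obtain ⟨v1, v2, v3, v4⟩ := hv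
    refine ⟨meetPar_ne_zero hsa v1, ?_, ?_, ?_⟩
    · intro h
      unfold meetPar at h
      rw [div_eq_div_iff (by simpa using v1) (by simpa using v2)] at h
      apply v4
      rw [mink_sub_left, mink_smul_left, mink_smul_left]
      linarith
    · refine hK.apply vv v0 v3 (meetPar_ne_zero hsa v1) ?_
      simpa only [ha] using hφ _ _ (adj_meetPar vv v1)
    · refine hK.apply vv v0 v3 (meetPar_ne_zero hsb v2) ?_
      simpa only [hb] using hφ _ _ (adj_meetPar vv v2)
  have hl : ∀ u ∈ [a - s, b - s, n,
      mink (a - s) (a - s) • (b - s) - mink (b - s) (b - s) • (a - s)], u ≠ 0 := by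
    simp only [List.mem_cons, List.not_mem_nil, or_false, forall_eq_or_imp, forall_eq]
    exact ⟨ne_zero_of_mink_ne_zero hA, ne_zero_of_mink_ne_zero hB, hK.2.1,
      smul_sub_smul_ne_zero hA hB hne⟩
  refine ⟨?_, _, hl, fun v vv v0 hv => ⟨_, _, key v vv v0 hv⟩⟩
  obtain ⟨v, vv, v0, hv⟩ := exists_null_generic _ hl
  rw [← (key v vv v0 hv).2.2.1]
  simpa only [ha] using hφ _ _ (adj_meetPar vv (hv (a - s) (by simp)))

theorem Concentrated.fat (hφ : Preserving φ) {s m n : Fin 4 → ℝ} (hr : Fat φ r)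
    (hs : ¬Adj (φ s) r) (hK : Concentrated φ r s m n) : Fat φ m := by
  obtain ⟨-, l, hl, h⟩ := hK.generic_pair hφ hr hs
  obtain ⟨v, vv, v0, hv⟩ := exists_null_generic l hl
  obtain ⟨κ, κ', -, hne, h1, h2⟩ := h v vv v0 hv
  refine ⟨_, _, adj_add_smul vv κ κ', fun heq => hne ?_, h1, h2⟩
  exact smul_left_injective ℝ v0 (add_left_cancel heq)

theorem Concentrated.adj_center (hφ : Preserving φ) {s m n : Fin 4 → ℝ} (hr : Fat φ r)
    (hs : ¬Adj (φ s) r) (hK : Concentrated φ r s m n) : Adj (φ s) m := by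
  obtain ⟨-, l, hl, h⟩ := hK.generic_pair hφ hr hs
  obtain ⟨v, vv, v0, hv⟩ := exists_null_generic l hl
  obtain ⟨κ, κ', -, -, h1, -⟩ := h v vv v0 hv
  rw [← h1]
  exact hφ _ _ (adj_add_smul_self vv κ).symm

/-- Two successive concentrations at events which are not lightlike. -/
theorem Concentrated.adj_of_not_adj (hφ : Preserving φ)
    (conc : ∀ r s, Fat φ r → ¬Adj (φ s) r → ∃ m n, Concentrated φ r s m n)
    {a b s t m ρ n n' : Fin 4 → ℝ} (hab : Adj a b) (hne : a ≠ b) (ha : φ a = r) (hb : φ b = r)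
    (hs : ¬Adj (φ s) r) (hK : Concentrated φ r s m n) (ht : ¬Adj (φ t) m) (hts : ¬Adj t s)
    (hK' : Concentrated φ m t ρ n') : Adj (φ s) ρ ∧ Adj t a := by
  have hr : Fat φ r := ⟨a, b, hab, hne, ha, hb⟩
  have hm := hK.fat hφ hr hs
  have hρ := hK'.fat hφ hm ht
  have has : ¬Adj a s := fun h => hs (by rw [← ha]; exact hφ _ _ h.symm)
  have hτ : mink (t - s) (t - s) ≠ 0 := hts
  have hA : mink (a - s) (a - s) ≠ 0 := has
  -- the consequences of a generic choice of direction
  have key : ∀ v, mink v v = 0 → v ≠ 0 → mink (t - s) v ≠ 0 → mink (a - s) v ≠ 0 →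
      mink n v ≠ 0 → mink (scaledRefl (t - s) n') v ≠ 0 →
      φ (s + meetPar s v a • v) = m ∧ ¬Adj ρ r ∧ φ (s + meetPar s v t • v) = ρ := by
    intro v vv v0 v1 v2 v3 v4
    have het : Adj (s + meetPar s v t • v) t := adj_meetPar vv v1
    have hy : φ (s + meetPar s v a • v) = m := by
      refine hK.apply vv v0 v3 (meetPar_ne_zero has v2) ?_
      simpa only [ha] using hφ _ _ (adj_meetPar vv v2)
    have her : ¬Adj (φ (s + meetPar s v t • v)) r := by
      intro her
      have := hK.apply vv v0 v3 (meetPar_ne_zero hts v1) her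
      apply ht
      rw [← this]
      exact hφ _ _ het.symm
    have hem : Adj (φ (s + meetPar s v t • v)) m := by
      rw [← hy]
      exact hφ _ _ (adj_add_smul vv _ _)
    have heρ : φ (s + meetPar s v t • v) = ρ :=
      hK'.2.2 _ het hem (meet_not_mem_line hK'.1 v1 v4)
    exact ⟨hy, by rwa [← heρ], heρ⟩
  have gen : ∀ l : List (Fin 4 → ℝ), (∀ u ∈ l, u ≠ 0) → ∃ v, mink v v = 0 ∧ v ≠ 0 ∧
      mink (t - s) v ≠ 0 ∧ mink (a - s) v ≠ 0 ∧ mink n v ≠ 0 ∧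
      mink (scaledRefl (t - s) n') v ≠ 0 ∧ ∀ u ∈ l, mink u v ≠ 0 := by
    intro l hl
    obtain ⟨v, vv, v0, hv⟩ := exists_null_generic
      ((t - s) :: (a - s) :: n :: scaledRefl (t - s) n' :: l) (by
        simp only [List.mem_cons, forall_eq_or_imp]
        exact ⟨ne_zero_of_mink_ne_zero hτ, ne_zero_of_mink_ne_zero hA, hK.2.1,
          scaledRefl_ne_zero hτ hK'.2.1, hl⟩)
    simp only [List.mem_cons, forall_eq_or_imp] at hv
    exact ⟨v, vv, v0, hv⟩
  obtain ⟨v, vv, v0, v1, v2, v3, v4, -⟩ := gen [] (by simp)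
  obtain ⟨-, hρr, heρ⟩ := key v vv v0 v1 v2 v3 v4
  refine ⟨by rw [← heρ]; exact hφ _ _ (adj_add_smul_self vv _).symm, ?_⟩
  clear heρ v1 v2 v3 v4 v0 vv v
  by_contra hta
  have hat : mink (a - t) (a - t) ≠ 0 := fun h => hta (Adj.symm h)
  obtain ⟨m', na, hKa⟩ := conc ρ a hρ (by rw [ha]; exact fun h => hρr h.symm)
  obtain ⟨v, vv, v0, v1, v2, v3, v4, hv⟩ := gen [scaledRefl (a - s) na, scaledRefl (t - s) (a - t),
    scaledRefl (t - s) (scaledRefl (a - t) na)] (by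
      simp only [List.mem_cons, List.not_mem_nil, or_false, forall_eq_or_imp, forall_eq]
      exact ⟨scaledRefl_ne_zero hA hKa.2.1, scaledRefl_ne_zero hτ (ne_zero_of_mink_ne_zero hat),
        scaledRefl_ne_zero hτ (scaledRefl_ne_zero hat hKa.2.1)⟩)
  simp only [List.mem_cons, List.not_mem_nil, or_false, forall_eq_or_imp, forall_eq] at hv
  obtain ⟨v5, v6, v7⟩ := hv
  rw [← mink_scaledRefl_comm] at v6 v7
  obtain ⟨hy, -, heρ⟩ := key v vv v0 v1 v2 v3 v4
  obtain ⟨w, hw⟩ : ∃ w, w = scaledRefl (t - s) v := ⟨_, rfl⟩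
  rw [← hw] at v6 v7
  have ww : mink w w = 0 := by rw [hw, mink_scaledRefl_self, vv, mul_zero]
  have hew : s + meetPar s v t • v = t + (2 * mink (t - s) v)⁻¹ • w := by
    rw [hw]
    unfold scaledRefl meetPar
    rw [smul_sub, smul_smul, smul_smul, inv_mul_cancel₀ (by simpa using v1), one_smul,
      div_eq_inv_mul]
    abel
  have hm' : m = m' := by
    rw [← hy]
    refine hKa.2.2 _ (adj_meetPar vv v2) ?_ (meet_not_mem_line hKa.1 v2 v5)
    rw [← heρ]
    exact hφ _ _ (adj_add_smul vv _ _)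
  have hf : φ (t + meetPar t w a • w) = m' := by
    refine hKa.2.2 _ (adj_meetPar ww v6) ?_ (meet_not_mem_line hKa.1 v6 v7)
    rw [← heρ, hew]
    exact hφ _ _ (adj_add_smul ww _ _)
  apply ht
  rw [hm', ← hf]
  exact hφ _ _ (adj_add_smul_self ww _).symm

theorem not_adj_add_smul {s t v : Fin 4 → ℝ} {κ : ℝ} (hst : Adj s t) (vv : mink v v = 0)
    (hv : mink (s - t) v ≠ 0) (hκ : κ ≠ 0) : ¬Adj (s + κ • v) t := by
  have h : mink (s - t) (s - t) = 0 := hst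
  unfold Adj
  rw [mink_add_smul_sub _ _ _ vv, h]
  simp [hv, hκ]

/-- If `φ` concentrates at `s₀` and then at `t`, the events whose image is not lightlike to the
second focus are lightlike to `t`. -/
theorem adj_of_concentrated_twice (hφ : Preserving φ)
    (conc : ∀ r s, Fat φ r → ¬Adj (φ s) r → ∃ m n, Concentrated φ r s m n)
    {s₀ t m ρ n n' : Fin 4 → ℝ} (hr : Fat φ r) (hs : ¬Adj (φ s₀) r)
    (hK : Concentrated φ r s₀ m n) (ht : ¬Adj (φ t) m) (hK' : Concentrated φ m t ρ n')
    (t' : Fin 4 → ℝ) (ht' : ¬Adj (φ t') ρ) : Adj t' t := by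
  by_contra hne
  have hm := hK.fat hφ hr hs
  have hρ := hK'.fat hφ hm ht
  obtain ⟨κ₂, n₂, hK₂⟩ := conc ρ t' hρ ht'
  obtain ⟨-, l, hl, hpair⟩ := hK.generic_pair hφ hr hs
  have key : ∀ v, mink v v = 0 → v ≠ 0 → (∀ u ∈ l, mink u v ≠ 0) → ∃ c : ℝ, t' = s₀ + c • v := by
    intro v vv v0 hv
    obtain ⟨κ, κ', -, hκ, h1, h2⟩ := hpair v vv v0 hv
    have hpts : s₀ + κ • v ≠ s₀ + κ' • v := fun heq =>
      hκ (smul_left_injective ℝ v0 (add_left_cancel heq))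
    have hadj := adj_add_smul (x := s₀) vv κ κ'
    have a1 := (Concentrated.adj_of_not_adj hφ conc hadj hpts h1 h2 ht hK' ht' hne hK₂).2
    have a2 :=
      (Concentrated.adj_of_not_adj hφ conc hadj.symm hpts.symm h2 h1 ht hK' ht' hne hK₂).2
    obtain ⟨c, hc⟩ := collinear_of_adj hadj a2.symm a1.symm hpts
    refine ⟨κ + c * (κ' - κ), hc.trans ?_⟩
    module
  obtain ⟨v, vv, v0, hv⟩ := exists_null_generic l hl
  obtain ⟨v', vv', v0', hv'⟩ := exists_null_generic (v :: l) (by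
    simp only [List.mem_cons, forall_eq_or_imp]
    exact ⟨v0, hl⟩)
  simp only [List.mem_cons, forall_eq_or_imp] at hv'
  obtain ⟨c, hc⟩ := key v vv v0 hv
  obtain ⟨c', hc'⟩ := key v' vv' v0' hv'.2
  have h1 : c • v = c' • v' := add_left_cancel (hc.symm.trans hc')
  have h2 := congrArg (fun y => mink v y) h1
  simp only [mink_smul_right, vv, mul_zero] at h2
  have h3 : c' = 0 := by simpa [hv'.1] using h2.symm
  rw [h3, zero_smul, add_zero] at hc'
  subst hc'
  obtain ⟨a, b, hab, hne', ha, hb⟩ := hr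
  exact ht' (Concentrated.adj_of_not_adj hφ conc hab hne' ha hb hs hK ht
    (fun h => hne h.symm) hK').1

theorem Concentrated.adj_of_not_mem_line (hφ : Preserving φ) {ρ t t₁ κ n : Fin 4 → ℝ}
    (ht : Adj (φ t) ρ) (hT : ∀ t', ¬Adj (φ t') ρ → Adj t' t) (h₁ : ¬Adj (φ t₁) ρ)
    (hK : Concentrated φ ρ t₁ κ n) (x : Fin 4 → ℝ) (hx : ∀ c : ℝ, x ≠ t₁ + c • n) :
    Adj (φ x) κ := by
  have h1t := hT t₁ h₁
  have hne : t₁ ≠ t := by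
    rintro rfl
    exact h₁ ht
  by_cases hxt : Adj x t₁
  · by_cases hxρ : Adj (φ x) ρ
    · rw [hK.2.2 x hxt hxρ hx]
      exact Adj.refl κ
    · have hxt' := hT x hxρ
      obtain ⟨d, hd⟩ := collinear_of_adj h1t hxt'.symm hxt.symm hne
      have : φ t = κ := by
        refine hK.2.2 t h1t.symm ht fun c hc => hx (d * c) ?_
        rw [hd, hc]
        module
      rw [← this]
      exact hφ _ _ hxt'
  · obtain ⟨v, vv, v0, hv⟩ := exists_null_generic [x - t₁, t₁ - t, n] (by
      simp only [List.mem_cons, List.not_mem_nil, or_false, forall_eq_or_imp, forall_eq]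
      exact ⟨ne_zero_of_mink_ne_zero hxt, sub_ne_zero.2 hne, hK.2.1⟩)
    simp only [List.mem_cons, List.not_mem_nil, or_false, forall_eq_or_imp, forall_eq] at hv
    obtain ⟨v1, v2, v3⟩ := hv
    have h0 := meetPar_ne_zero hxt v1
    have hf : Adj (φ (t₁ + meetPar t₁ v x • v)) ρ := by
      by_contra hf
      exact not_adj_add_smul h1t vv v2 h0 (hT _ hf)
    rw [← hK.apply vv v0 v3 h0 hf]
    exact hφ _ _ (adj_meetPar vv v1).symm

/-- If two distinct lightlike events have the same image, then `φ` degenerates. -/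
theorem Preserving.exists_line_of_fat (hφ : Preserving φ) {r₀ : Fin 4 → ℝ} (hr₀ : Fat φ r₀)
    (hN : ∀ r r', ∃ s, s ≠ r ∧ ¬Adj (φ s) r') :
    ∃ ℓ ℓ' : Set (Fin 4 → ℝ), IsLightlikeLine ℓ ∧ IsLightlikeLine ℓ' ∧
      ∀ s : Fin 4 → ℝ, s ∉ ℓ → φ s ∈ ℓ' := by
  have conc : ∀ r s, Fat φ r → ¬Adj (φ s) r → ∃ m n, Concentrated φ r s m n := by
    intro r s ⟨a, b, hab, hne, ha, hb⟩ hs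
    by_contra hK
    push Not at hK
    obtain ⟨x, hx, hxr⟩ := hN s r
    exact hxr (hφ.adj_of_not_concentrated hs hK hab hne ha hb x hx)
  obtain ⟨s₀, -, hs₀⟩ := hN 0 r₀
  obtain ⟨m, n₀, hK₀⟩ := conc r₀ s₀ hr₀ hs₀
  have hm := hK₀.fat hφ hr₀ hs₀
  obtain ⟨t, -, ht⟩ := hN 0 m
  obtain ⟨ρ, n', hK'⟩ := conc m t hm ht
  have hρ := hK'.fat hφ hm ht
  have htρ := hK'.adj_center hφ hm ht
  have hT := adj_of_concentrated_twice hφ conc hr₀ hs₀ hK₀ ht hK'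
  obtain ⟨t₁, -, h₁⟩ := hN 0 ρ
  obtain ⟨κ, n₁, hK₁⟩ := conc ρ t₁ hρ h₁
  have off₁ := hK₁.adj_of_not_mem_line hφ htρ hT h₁
  have hκρ := (hK₁.generic_pair hφ hρ h₁).1
  have hφ₁ := hK₁.adj_center hφ hρ h₁
  have hκne : ρ ≠ κ := by
    rintro rfl
    exact h₁ hφ₁
  by_cases hcase : ∀ x, ¬Adj (φ x) ρ → ∃ c : ℝ, x = t₁ + c • n₁
  · refine ⟨{x | ∃ c : ℝ, x = t₁ + c • n₁}, {x | ∃ c : ℝ, x = ρ + c • (κ - ρ)},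
      ⟨_, _, hK₁.2.1, hK₁.1, rfl⟩, ⟨_, _, sub_ne_zero.2 hκne.symm, hκρ, rfl⟩, fun x hx => ?_⟩
    have hxρ : Adj (φ x) ρ := by
      by_contra h
      exact hx (hcase x h)
    have hxκ := off₁ x fun c hc => hx ⟨c, hc⟩
    exact collinear_of_adj hκρ.symm hxκ.symm hxρ.symm hκne
  · exfalso
    push Not at hcase
    obtain ⟨t₂, h₂, hoff⟩ := hcase
    obtain ⟨κ₂, n₂, hK₂⟩ := conc ρ t₂ hρ h₂
    have off₂ := hK₂.adj_of_not_mem_line hφ htρ hT h₂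
    have hκ₂ρ := (hK₂.generic_pair hφ hρ h₂).1
    have hφ₂ := hK₂.adj_center hφ hρ h₂
    have h2t := hT t₂ h₂
    have hne : t₂ ≠ t := by
      rintro rfl
      exact h₂ htρ
    obtain ⟨v, vv, v0, hv⟩ := exists_null_generic [t₂ - t, n₁, n₂] (by
      simp only [List.mem_cons, List.not_mem_nil, or_false, forall_eq_or_imp, forall_eq]
      exact ⟨sub_ne_zero.2 hne, hK₁.2.1, hK₂.2.1⟩)
    simp only [List.mem_cons, List.not_mem_nil, or_false, forall_eq_or_imp, forall_eq] at hv
    obtain ⟨v1, v2, v3⟩ := hv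
    have hκκ₂ : Adj κ₂ κ := by
      have hval : ∀ c : ℝ, c ≠ 0 → φ (t₂ + c • v) = κ₂ := fun c hc => by
        refine hK₂.apply vv v0 v3 hc ?_
        by_contra hf
        exact not_adj_add_smul h2t vv v1 hc (hT _ hf)
      by_cases h : ∀ c : ℝ, t₂ + (1 : ℝ) • v ≠ t₁ + c • n₁
      · rw [← hval 1 one_ne_zero]
        exact off₁ _ h
      · push Not at h
        obtain ⟨c, hc⟩ := h
        rw [← hval 2 two_ne_zero]
        refine off₁ _ fun d hd => ?_
        have hvn : v = (d - c) • n₁ := by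
          have : v = (t₂ + (2 : ℝ) • v) - (t₂ + (1 : ℝ) • v) := by module
          rw [this, hd, hc]
          module
        have h3 := mink_smul_left (d - c) n₁ v
        rw [← hvn, vv] at h3
        have h4 : d - c = 0 := by simpa [v2] using h3.symm
        rw [h4, zero_smul] at hvn
        exact v0 hvn
    have heq : κ = κ₂ := by
      by_contra hκ
      exact h₂ (adj_of_diamond hκκ₂.symm hκ (off₁ t₂ hoff) hφ₂ hκρ.symm hκ₂ρ.symm)
    subst heq
    by_cases hint : ∃ c : ℝ, ∃ d : ℝ, t₁ + c • n₁ = t₂ + d • n₂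
    · obtain ⟨c, d, hcd⟩ := hint
      obtain ⟨x, hx, hxκ⟩ := hN (t₁ + c • n₁) κ
      have e1 : ∃ c' : ℝ, x = t₁ + c' • n₁ := by
        by_contra h
        push Not at h
        exact hxκ (off₁ x h)
      have e2 : ∃ d' : ℝ, x = t₂ + d' • n₂ := by
        by_contra h
        push Not at h
        exact hxκ (off₂ x h)
      obtain ⟨c', hc'⟩ := e1
      obtain ⟨d', hd'⟩ := e2
      have hdd : d' - d ≠ 0 := by
        intro h
        apply hx
        rw [hd', hcd, sub_eq_zero.1 h]
      have hn : n₂ = ((d' - d)⁻¹ * (c' - c)) • n₁ := by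
        have : (d' - d) • n₂ = (c' - c) • n₁ := by
          have e : (d' - d) • n₂ = (t₂ + d' • n₂) - (t₂ + d • n₂) := by module
          rw [e, ← hd', ← hcd, hc']
          module
        rw [mul_smul, ← this, smul_smul, inv_mul_cancel₀ hdd, one_smul]
      obtain ⟨g, hg⟩ : ∃ g, g = (d' - d)⁻¹ * (c' - c) := ⟨_, rfl⟩
      rw [← hg] at hn
      refine hoff (c - d * g) ?_
      have : t₂ = (t₂ + d • n₂) - d • n₂ := by abel
      rw [this, ← hcd, hn]
      module
    · push Not at hint
      obtain ⟨x, -, hxκ⟩ := hN 0 κ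
      by_cases h : ∃ c : ℝ, x = t₁ + c • n₁
      · obtain ⟨c, hc⟩ := h
        exact hxκ (off₂ x fun d hd => hint c d (hc.symm.trans hd))
      · push Not at h
        exact hxκ (off₁ x h)

theorem Preserving.adj_images_of_not_adj (hφ : Preserving φ)
    (hinj : ∀ x y, Adj x y → φ x = φ y → x = y) {x y : Fin 4 → ℝ} (hxy : ¬Adj x y)
    (hadj : Adj (φ x) (φ y)) (hne : φ x ≠ φ y) (z : Fin 4 → ℝ) :
    Adj (φ z) (φ x) ∧ Adj (φ z) (φ y) := by
  have hyx : ¬Adj y x := fun h => hxy h.symm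
  have meet : ∀ z, Adj z x → Adj z y → Adj (φ z) (φ x) ∧ Adj (φ z) (φ y) :=
    fun z h1 h2 => ⟨hφ _ _ h1, hφ _ _ h2⟩
  have hx : Adj (φ x) (φ x) ∧ Adj (φ x) (φ y) := ⟨Adj.refl _, hadj⟩
  have hy : Adj (φ y) (φ x) ∧ Adj (φ y) (φ y) := ⟨hadj.symm, Adj.refl _⟩
  have line : ∀ p q u, Adj p q → p ≠ q → (Adj (φ p) (φ x) ∧ Adj (φ p) (φ y)) →
      (Adj (φ q) (φ x) ∧ Adj (φ q) (φ y)) → Adj u p → Adj u q →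
      Adj (φ u) (φ x) ∧ Adj (φ u) (φ y) := by
    intro p q u hpq hne hp hq hup huq
    have h1 : φ p ≠ φ q := fun h => hne (hinj p q hpq h)
    exact ⟨adj_of_diamond (hφ _ _ hpq) h1 (hφ _ _ hup) (hφ _ _ huq) hp.1.symm hq.1.symm,
      adj_of_diamond (hφ _ _ hpq) h1 (hφ _ _ hup) (hφ _ _ huq) hp.2.symm hq.2.symm⟩
  have linex : ∀ p, Adj p x → mink (y - x) (p - x) ≠ 0 →
      Adj (φ p) (φ x) ∧ Adj (φ p) (φ y) := by
    intro p hp h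
    have vv : mink (p - x) (p - x) = 0 := hp
    have h0 := meetPar_ne_zero hyx h
    refine line x (x + meetPar x (p - x) y • (p - x)) p (adj_add_smul_self vv _).symm ?_ hx
      (meet _ (adj_add_smul_self vv _) (adj_meetPar vv h)) hp ?_
    · intro heq
      rw [left_eq_add, smul_eq_zero] at heq
      refine heq.elim h0 fun h1 => h ?_
      rw [h1, mink_zero_right]
    · simpa using adj_add_smul (x := x) vv 1 (meetPar x (p - x) y)
  have liney : ∀ p, Adj p y → mink (x - y) (p - y) ≠ 0 →
      Adj (φ p) (φ x) ∧ Adj (φ p) (φ y) := by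
    intro p hp h
    have vv : mink (p - y) (p - y) = 0 := hp
    have h0 := meetPar_ne_zero hxy h
    refine line y (y + meetPar y (p - y) x • (p - y)) p (adj_add_smul_self vv _).symm ?_ hy
      (meet _ (adj_meetPar vv h) (adj_add_smul_self vv _)) hp ?_
    · intro heq
      rw [left_eq_add, smul_eq_zero] at heq
      refine heq.elim h0 fun h1 => h ?_
      rw [h1, mink_zero_right]
    · simpa using adj_add_smul (x := y) vv 1 (meetPar y (p - y) x)
  have aux : ∀ {z v a b : Fin 4 → ℝ}, mink (a - z) v ≠ 0 →
      mink (scaledRefl (a - z) (b - a)) v ≠ 0 →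
      mink (b - a) (z + meetPar z v a • v - a) ≠ 0 := by
    intro z v a b h1 h2 h3
    apply h2
    have e : z + meetPar z v a • v - a = meetPar z v a • v - (a - z) := by abel
    rw [e, mink_sub_right, mink_smul_right] at h3
    unfold meetPar at h3
    rw [mink_scaledRefl_left, mink_comm (a - z) (b - a)]
    field_simp at h3
    linarith
  have off : ∀ z, ¬Adj z x → ¬Adj z y → Adj (φ z) (φ x) ∧ Adj (φ z) (φ y) := by
    intro z hzx hzy
    have hX : mink (x - z) (x - z) ≠ 0 := fun h => hzx (Adj.symm h)
    have hY : mink (y - z) (y - z) ≠ 0 := fun h => hzy (Adj.symm h)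
    have hne' : x ≠ y := by
      rintro rfl
      exact hxy (Adj.refl _)
    obtain ⟨v, vv, v0, hv⟩ := exists_null_generic [x - z, y - z,
      scaledRefl (x - z) (y - x), scaledRefl (y - z) (x - y),
      mink (x - z) (x - z) • (y - z) - mink (y - z) (y - z) • (x - z)] (by
        simp only [List.mem_cons, List.not_mem_nil, or_false, forall_eq_or_imp, forall_eq]
        exact ⟨ne_zero_of_mink_ne_zero hX, ne_zero_of_mink_ne_zero hY,
          scaledRefl_ne_zero hX (sub_ne_zero.2 hne'.symm),
          scaledRefl_ne_zero hY (sub_ne_zero.2 hne'), smul_sub_smul_ne_zero hX hY hne'⟩)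
    simp only [List.mem_cons, List.not_mem_nil, or_false, forall_eq_or_imp, forall_eq] at hv
    obtain ⟨v1, v2, v3, v4, v5⟩ := hv
    refine line (z + meetPar z v x • v) (z + meetPar z v y • v) z (adj_add_smul vv _ _) ?_
      (linex _ (adj_meetPar vv v1) (aux v1 v3)) (liney _ (adj_meetPar vv v2) (aux v2 v4))
      (adj_add_smul_self vv _).symm (adj_add_smul_self vv _).symm
    intro heq
    have h := smul_left_injective ℝ v0 (add_left_cancel heq)
    simp only [meetPar] at h
    rw [div_eq_div_iff (by simpa using v1) (by simpa using v2)] at h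
    apply v5
    rw [mink_sub_left, mink_smul_left, mink_smul_left]
    linarith
  by_cases hzx : z = x
  · rwa [hzx]
  by_cases hzy : z = y
  · rwa [hzy]
  obtain ⟨v, vv, v0, hv⟩ := exists_null_generic [z - x, z - y] (by
    simp only [List.mem_cons, List.not_mem_nil, or_false, forall_eq_or_imp, forall_eq]
    exact ⟨sub_ne_zero.2 hzx, sub_ne_zero.2 hzy⟩)
  simp only [List.mem_cons, List.not_mem_nil, or_false, forall_eq_or_imp, forall_eq] at hv
  have param : ∀ w, mink (z - w) v ≠ 0 → ∃ c : ℝ, ∀ κ, c < κ → ¬Adj (z + κ • v) w := by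
    intro w hw
    refine ⟨-mink (z - w) (z - w) / (2 * mink (z - w) v), fun κ hκ h => hκ.ne ?_⟩
    unfold Adj at h
    rw [mink_add_smul_sub _ _ _ vv] at h
    field_simp
    linarith
  obtain ⟨c, hc⟩ := param x hv.1
  obtain ⟨d, hd⟩ := param y hv.2
  have l1 := le_max_left c d
  have l2 := le_max_right c d
  refine line (z + (max c d + 1) • v) (z + (max c d + 2) • v) z (adj_add_smul vv _ _) ?_
    (off _ (hc _ (by linarith)) (hd _ (by linarith)))
    (off _ (hc _ (by linarith)) (hd _ (by linarith)))
    (adj_add_smul_self vv _).symm (adj_add_smul_self vv _).symm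
  intro heq
  have h : max c d + 1 = max c d + 2 := smul_left_injective ℝ v0 (add_left_cancel heq)
  linarith

/-- If some pair of events becomes lightlike, then the whole image lies in a lightlike line. -/
theorem Preserving.exists_line_of_not_adj (hφ : Preserving φ)
    (hinj : ∀ x y, Adj x y → φ x = φ y → x = y) {x y : Fin 4 → ℝ} (hxy : ¬Adj x y)
    (hadj : Adj (φ x) (φ y)) :
    ∃ ℓ ℓ' : Set (Fin 4 → ℝ), IsLightlikeLine ℓ ∧ IsLightlikeLine ℓ' ∧
      ∀ s : Fin 4 → ℝ, s ∉ ℓ → φ s ∈ ℓ' := by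
  obtain ⟨x', hx', hadj', hne⟩ : ∃ x', ¬Adj x' y ∧ Adj (φ x') (φ y) ∧ φ x' ≠ φ y := by
    by_cases hne : φ x = φ y
    · have h0 : mink (x - y) (x - y) ≠ 0 := hxy
      obtain ⟨v, vv, v0, hv⟩ := exists_null_generic [x - y] (by
        simpa using ne_zero_of_mink_ne_zero h0)
      have hv := hv (x - y) (by simp)
      have hκ : mink (x - y) (x - y) / mink (x - y) v ≠ 0 := div_ne_zero h0 hv
      refine ⟨x + (mink (x - y) (x - y) / mink (x - y) v) • v, ?_, ?_, ?_⟩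
      · intro h
        unfold Adj at h
        rw [mink_add_smul_sub _ _ _ vv] at h
        field_simp at h
        apply h0
        linarith
      · rw [← hne]
        exact hφ _ _ (adj_add_smul_self vv _)
      · rw [← hne]
        intro h
        have := hinj _ _ (adj_add_smul_self vv _) h
        rw [add_eq_left, smul_eq_zero] at this
        exact this.elim hκ v0
    · exact ⟨x, hxy, hadj, hne⟩
  obtain ⟨v, vv, v0, -⟩ := exists_null_generic [] (by simp)
  refine ⟨_, {z | ∃ c : ℝ, z = φ x' + c • (φ y - φ x')}, ⟨0, v, v0, vv, rfl⟩,
    ⟨_, _, sub_ne_zero.2 hne.symm, hadj'.symm, rfl⟩, fun s _ => ?_⟩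
  have := hφ.adj_images_of_not_adj hinj hx' hadj' hne s
  exact collinear_of_adj hadj' this.2.symm this.1.symm hne

end Preserving

/-- Future directed null vectors. -/
def FutureNull (v : Fin 4 → ℝ) : Prop := mink v v = 0 ∧ 0 < v 3

theorem FutureNull.ne_zero {v : Fin 4 → ℝ} (hv : FutureNull v) : v ≠ 0 := by
  rintro rfl
  exact lt_irrefl _ hv.2

theorem FutureNull.smul {v : Fin 4 → ℝ} (hv : FutureNull v) {c : ℝ} (hc : 0 < c) :
    FutureNull (c • v) := by
  refine ⟨by rw [mink_smul_left, mink_smul_right, hv.1]; ring, ?_⟩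
  simpa using mul_pos hc hv.2

theorem FutureNull.mink_pos {v w : Fin 4 → ℝ} (hv : FutureNull v) (hw : FutureNull w)
    (h : mink v w ≠ 0) : 0 < mink v w :=
  lt_of_le_of_ne (mink_nonneg_of_null hv.1 hw.1 (mul_pos hv.2 hw.2).le) h.symm

theorem FutureNull.of_mink_pos {v w : Fin 4 → ℝ} (hv : FutureNull v) (hw : mink w w = 0)
    (h : 0 < mink w v) : FutureNull w := by
  refine ⟨hw, ?_⟩
  by_contra h3
  have := mink_nonneg_of_null (v := -w) (w := v)
    (by rw [mink_neg_left, mink_neg_right, hw]; simp) hv.1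
    (by simp only [Pi.neg_apply]; nlinarith [hv.2])
  rw [mink_neg_left] at this
  linarith

theorem exists_futureNull_generic (l : List (Fin 4 → ℝ)) (hl : ∀ u ∈ l, u ≠ 0) :
    ∃ v, FutureNull v ∧ ∀ u ∈ l, mink u v ≠ 0 := by
  obtain ⟨v, vv, v0, hv⟩ := exists_null_generic l hl
  rcases lt_or_gt_of_ne (last_ne_zero_of_null vv v0) with h | h
  · refine ⟨-v, ⟨by rw [mink_neg_left, mink_neg_right, vv]; simp, by simpa using h⟩, ?_⟩
    intro u hu
    rw [mink_neg_right]
    exact neg_ne_zero.2 (hv u hu)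
  · exact ⟨v, ⟨vv, h⟩, hv⟩

/-- Two future null vectors which are not parallel have equal products with a third one. -/
theorem FutureNull.exists_mink_eq {w w' : Fin 4 → ℝ} (hw : FutureNull w) (hw' : FutureNull w')
    (h : mink w' w ≠ 0) : ∃ v, FutureNull v ∧ mink v w = 1 ∧ mink v w' = 1 := by
  have hμ := hw'.mink_pos hw h
  obtain ⟨k, e₁, e₂, F⟩ := exists_nullFrame hw.1 hw.ne_zero
  obtain ⟨z, hz⟩ := F.exists_nullAt_eq (v := (mink w' w)⁻¹ • w')
    (by rw [mink_smul_left, mink_smul_right, hw'.1]; ring)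
    (by rw [mink_smul_left, inv_mul_cancel₀ h])
  have h1 := F.mink_nullAt_h (z.1 + √(2 / mink w' w), z.2)
  refine ⟨nullAt w k e₁ e₂ (z.1 + √(2 / mink w' w), z.2),
    hw.of_mink_pos (F.nullAt_null _) (by rw [h1]; exact one_pos), h1, ?_⟩
  have h2 : w' = mink w' w • nullAt w k e₁ e₂ z := by
    rw [hz, smul_smul, mul_inv_cancel₀ h, one_smul]
  obtain ⟨μ, hμ'⟩ : ∃ μ, μ = mink w' w := ⟨_, rfl⟩
  rw [← hμ'] at h2 hμ ⊢
  rw [h2, mink_smul_right, F.mink_nullAt_nullAt]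
  simp only [add_sub_cancel_left, sub_self]
  rw [Real.sq_sqrt (by positivity)]
  field_simp
  ring

/-- An additive function of constant sign on the positive reals is linear. -/
theorem eq_mul_of_additive {K : ℝ → ℝ} (hadd : ∀ x y, 0 < x → 0 < y → K (x + y) = K x + K y)
    (hpos : ∀ x, 0 < x → 0 < K x * K 1) (x : ℝ) (hx : 0 < x) : K x = x * K 1 := by
  have hnat : ∀ (n : ℕ) (y : ℝ), 0 < y → K ((n + 1 : ℕ) * y) = (n + 1 : ℕ) * K y := by
    intro n y hy
    induction n with
    | zero => simp
    | succ n ih =>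
      have : ((n + 1 + 1 : ℕ) : ℝ) * y = (n + 1 : ℕ) * y + y := by push_cast; ring
      rw [this, hadd _ _ (by positivity) hy, ih]
      push_cast
      ring
  have hnat' : ∀ (n : ℕ) (y : ℝ), 0 < n → 0 < y → K (n * y) = n * K y := by
    intro n y hn hy
    obtain ⟨m, rfl⟩ := Nat.exists_eq_succ_of_ne_zero hn.ne'
    exact hnat m y hy
  have hrat : ∀ q : ℚ, 0 < q → K q = q * K 1 := by
    intro q hq
    have hnum : 0 < q.num.toNat := by
      have := Rat.num_pos.2 hq
      omega
    have hq' : (0 : ℝ) < q := by exact_mod_cast hq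
    have hden : (0 : ℝ) < q.den := by exact_mod_cast q.den_pos
    have e : (q.den : ℝ) * q = q.num.toNat := by
      have h1 : ((q.num.toNat : ℤ) : ℝ) = q.num := by
        rw [Int.toNat_of_nonneg (Rat.num_pos.2 hq).le]
      have h2 : (q.den : ℚ) * q = q.num := by rw [mul_comm]; exact Rat.mul_den_eq_num q
      have h3 : (q.den : ℝ) * q = q.num := by exact_mod_cast h2
      rw [h3, ← h1, Int.cast_natCast]
    have h1 := hnat' q.den q q.den_pos hq'
    have h2 := hnat' q.num.toNat 1 hnum one_pos
    rw [mul_one] at h2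
    rw [e, h2, ← e] at h1
    exact mul_left_cancel₀ hden.ne' (by linarith)
  have h1 : 0 < K 1 * K 1 := hpos 1 one_pos
  have h10 : K 1 ≠ 0 := by
    intro h
    rw [h] at h1
    simp at h1
  have hmono : ∀ a b, 0 < a → a < b → K a * K 1 < K b * K 1 := by
    intro a b ha hab
    have := hadd a (b - a) ha (by linarith)
    rw [add_sub_cancel] at this
    rw [this, add_mul]
    linarith [hpos (b - a) (by linarith)]
  have hxp := hpos x hx
  apply mul_right_cancel₀ h10
  rw [mul_assoc]
  obtain ⟨y, hy⟩ : ∃ y, y = K x * K 1 / (K 1 * K 1) := ⟨_, rfl⟩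
  have hKx : K x * K 1 = y * (K 1 * K 1) := by rw [hy]; field_simp
  have hy0 : 0 < y := by rw [hy]; positivity
  rw [hKx]
  rcases lt_trichotomy y x with h | h | h
  · obtain ⟨q, hq1, hq2⟩ := exists_rat_btwn h
    have hq0 : (0 : ℝ) < q := hy0.trans hq1
    have h2 := hmono q x hq0 hq2
    rw [hrat q (by exact_mod_cast hq0), hKx, mul_assoc] at h2
    nlinarith
  · rw [h]
  · obtain ⟨q, hq1, hq2⟩ := exists_rat_btwn h
    have hq0 : (0 : ℝ) < q := hx.trans hq1
    have h2 := hmono x q hx hq1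
    rw [hrat q (by exact_mod_cast hq0), hKx, mul_assoc] at h2
    nlinarith

/-- Injective maps fixing the origin which preserve lightlikeness in both directions. -/
structure IsStrict (φ : (Fin 4 → ℝ) → (Fin 4 → ℝ)) : Prop where
  zero : φ 0 = 0
  adj : ∀ x y, Adj (φ x) (φ y) ↔ Adj x y
  inj : Function.Injective φ

/-- The conjugate of `φ` by inversion. -/
def invConj (φ : (Fin 4 → ℝ) → (Fin 4 → ℝ)) (ξ : Fin 4 → ℝ) : Fin 4 → ℝ := hypInv (φ (hypInv ξ))

/-- The common value of `⟨invConj φ ξ, φ v⟩` for `⟨ξ, v⟩ = s`. -/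
def heightMap (φ : (Fin 4 → ℝ) → (Fin 4 → ℝ)) (v : Fin 4 → ℝ) (s : ℝ) : ℝ :=
  φ v 3 / (2 * φ (planeInv v s) 3)

namespace IsStrict

variable {φ : (Fin 4 → ℝ) → (Fin 4 → ℝ)}

theorem null_iff (hφ : IsStrict φ) (x : Fin 4 → ℝ) :
    mink (φ x) (φ x) = 0 ↔ mink x x = 0 := by
  simpa [Adj, hφ.zero] using hφ.adj x 0

theorem ne_zero (hφ : IsStrict φ) {x : Fin 4 → ℝ} (hx : x ≠ 0) : φ x ≠ 0 := by
  rw [← hφ.zero]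
  exact hφ.inj.ne hx

theorem mink_ne_zero (hφ : IsStrict φ) {v w : Fin 4 → ℝ} (hv : mink v v = 0)
    (hw : mink w w = 0) (h : mink v w ≠ 0) : mink (φ v) (φ w) ≠ 0 := by
  have h1 := hφ.adj v w
  rw [adj_iff, adj_iff, hv, hw, (hφ.null_iff v).2 hv, (hφ.null_iff w).2 hw] at h1
  intro h2
  rw [h2] at h1
  have := h1.1 (by ring)
  apply h
  linarith

theorem map_smul_null (hφ : IsStrict φ) {v : Fin 4 → ℝ} (hv : mink v v = 0) (h0 : v ≠ 0)
    (t : ℝ) : φ (t • v) = (φ (t • v) 3 / φ v 3) • φ v := by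
  have htv : mink (t • v) (t • v) = 0 := by rw [mink_smul_left, mink_smul_right, hv]; ring
  have hadj : Adj v (t • v) := by
    simpa using adj_add_smul (x := 0) hv 1 t
  have h1 := (hφ.adj _ _).2 hadj
  have v1 := (hφ.null_iff v).2 hv
  have v2 := (hφ.null_iff _).2 htv
  rw [adj_iff, v1, v2] at h1
  obtain ⟨c, hc⟩ := null_parallel_of_orthogonal v1 (hφ.ne_zero h0) v2 (by linarith)
  have h3 := last_ne_zero_of_null v1 (hφ.ne_zero h0)
  rw [hc, Pi.smul_apply, smul_eq_mul, mul_div_assoc, div_self h3, mul_one]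

theorem last_ne_zero (hφ : IsStrict φ) {v : Fin 4 → ℝ} (hv : mink v v = 0) (h0 : v ≠ 0) :
    φ v 3 ≠ 0 := last_ne_zero_of_null ((hφ.null_iff v).2 hv) (hφ.ne_zero h0)

theorem last_planeInv_ne_zero (hφ : IsStrict φ) {v : Fin 4 → ℝ} (hv : mink v v = 0)
    (h0 : v ≠ 0) {s : ℝ} (hs : s ≠ 0) : φ (planeInv v s) 3 ≠ 0 := by
  refine hφ.last_ne_zero ?_ (smul_ne_zero (inv_ne_zero (mul_ne_zero two_ne_zero hs)) h0)
  unfold planeInv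
  rw [mink_smul_left, mink_smul_right, hv]
  ring

theorem heightMap_injOn (hφ : IsStrict φ) {v : Fin 4 → ℝ} (hv : mink v v = 0) (h0 : v ≠ 0)
    {s s' : ℝ} (hs : s ≠ 0) (hs' : s' ≠ 0) (h : heightMap φ v s = heightMap φ v s') :
    s = s' := by
  have h1 := hφ.last_ne_zero hv h0
  have h2 := hφ.last_planeInv_ne_zero hv h0 hs
  have h3 := hφ.last_planeInv_ne_zero hv h0 hs'
  unfold heightMap at h
  have h4 : φ (planeInv v s) 3 = φ (planeInv v s') 3 := by
    field_simp at h
    exact h.symm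
  have h5 : φ (planeInv v s) = φ (planeInv v s') := by
    unfold planeInv at *
    rw [hφ.map_smul_null hv h0, h4, ← hφ.map_smul_null hv h0]
  have h6 : (2 * s)⁻¹ = (2 * s')⁻¹ := smul_left_injective ℝ h0 (hφ.inj h5)
  have h7 := inv_injective h6
  linarith

theorem hypInv_ne (hφ : IsStrict φ) {ξ : Fin 4 → ℝ} (hξ : mink ξ ξ ≠ 0) :
    mink (φ (hypInv ξ)) (φ (hypInv ξ)) ≠ 0 := by
  rw [Ne, hφ.null_iff, mink_hypInv]
  exact inv_ne_zero hξ

theorem invConj_ne (hφ : IsStrict φ) {ξ : Fin 4 → ℝ} (hξ : mink ξ ξ ≠ 0) :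
    mink (invConj φ ξ) (invConj φ ξ) ≠ 0 := by
  unfold invConj
  rw [mink_hypInv]
  exact inv_ne_zero (hφ.hypInv_ne hξ)

theorem mink_invConj_planeInv (hφ : IsStrict φ) {v ξ : Fin 4 → ℝ} (hv : mink v v = 0)
    (hξ : mink ξ ξ ≠ 0) (h : mink ξ v ≠ 0) :
    mink (invConj φ ξ) (φ (planeInv v (mink ξ v))) = 1 / 2 := by
  have h1 := (hφ.adj _ _).2 (adj_planeInv hv hξ h)
  have h2 : mink (φ (planeInv v (mink ξ v))) (φ (planeInv v (mink ξ v))) = 0 := by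
    rw [hφ.null_iff]
    unfold planeInv
    rw [mink_smul_left, mink_smul_right, hv]
    ring
  rw [adj_iff, h2] at h1
  have h3 := hφ.hypInv_ne hξ
  have : invConj φ ξ = (mink (φ (hypInv ξ)) (φ (hypInv ξ)))⁻¹ • φ (hypInv ξ) := rfl
  rw [this, mink_smul_left]
  field_simp
  linarith

theorem mink_invConj (hφ : IsStrict φ) {v ξ : Fin 4 → ℝ} (hv : mink v v = 0) (h0 : v ≠ 0)
    (hξ : mink ξ ξ ≠ 0) (h : mink ξ v ≠ 0) :
    mink (invConj φ ξ) (φ v) = heightMap φ v (mink ξ v) := by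
  have h1 := hφ.mink_invConj_planeInv hv hξ h
  have h2 := hφ.last_planeInv_ne_zero hv h0 h
  have h3 := hφ.last_ne_zero hv h0
  unfold heightMap
  unfold planeInv at *
  rw [hφ.map_smul_null hv h0, mink_smul_right] at h1
  generalize φ ((2 * mink ξ v)⁻¹ • v) 3 = a at *
  field_simp at h1 ⊢
  linarith

theorem invConj_add (hφ : IsStrict φ) {w ξ : Fin 4 → ℝ} (hw : mink w w = 0) (h0 : w ≠ 0)
    (hξ : mink ξ ξ ≠ 0) (hξw : mink (ξ + w) (ξ + w) ≠ 0) (h : mink ξ w ≠ 0) :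
    ∃ c : ℝ, invConj φ (ξ + w) = invConj φ ξ + c • φ w := by
  have h1 : mink (ξ + w) w = mink ξ w := by rw [mink_add_left, hw, add_zero]
  have h2 := hφ.mink_invConj hw h0 hξ h
  have h3 := hφ.mink_invConj hw h0 hξw (by rwa [h1])
  rw [h1, ← h2] at h3
  have hadj : Adj (ξ + w) ξ := by simpa using adj_add_smul_self (x := ξ) hw 1
  have h4 : Adj (invConj φ (ξ + w)) (invConj φ ξ) :=
    adj_hypInv (hφ.hypInv_ne hξw) (hφ.hypInv_ne hξ)
      ((hφ.adj _ _).2 (adj_hypInv hξw hξ hadj))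
  obtain ⟨c, hc⟩ := null_parallel_of_orthogonal ((hφ.null_iff w).2 hw) (hφ.ne_zero h0) h4
    (by rw [mink_sub_right, mink_comm _ (invConj φ ξ), mink_comm, h3, sub_self])
  exact ⟨c, by rw [← hc]; abel⟩

theorem heightMap_increment (hφ : IsStrict φ) {v v' w : Fin 4 → ℝ} (hv : FutureNull v)
    (hv' : FutureNull v') (hw : FutureNull w) (hvv' : mink v v' ≠ 0) (hwv : mink w v ≠ 0)
    (hwv' : mink w v' ≠ 0) {s s' : ℝ} (hs : 0 < s) (hs' : 0 < s') :
    (heightMap φ v (s + mink w v) - heightMap φ v s) * mink (φ w) (φ v') =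
      (heightMap φ v' (s' + mink w v') - heightMap φ v' s') * mink (φ w) (φ v) := by
  have p1 := hv.mink_pos hv' hvv'
  have p2 := hw.mink_pos hv hwv
  have p3 := hw.mink_pos hv' hwv'
  obtain ⟨ξ, hξ⟩ : ∃ ξ, ξ = (s / mink v v') • v' + (s' / mink v v') • v := ⟨_, rfl⟩
  have e1 : mink ξ v = s := by
    rw [hξ, mink_add_left, mink_smul_left, mink_smul_left, hv.1, mink_comm v' v]
    field_simp
    ring
  have e2 : mink ξ v' = s' := by
    rw [hξ, mink_add_left, mink_smul_left, mink_smul_left, hv'.1]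
    field_simp
    ring
  have e3 : 0 < mink ξ w := by
    rw [hξ, mink_add_left, mink_smul_left, mink_smul_left, mink_comm v' w, mink_comm v w]
    positivity
  have e4 : 0 < mink ξ ξ := by
    nth_rw 2 [hξ]
    rw [mink_add_right, mink_smul_right, mink_smul_right, e1, e2]
    positivity
  have e5 : 0 < mink (ξ + w) (ξ + w) := by
    rw [mink_add_left, mink_add_right, mink_add_right, hw.1, mink_comm w ξ]
    linarith
  obtain ⟨c, hc⟩ := hφ.invConj_add hw.1 hw.ne_zero e4.ne' e5.ne' e3.ne'
  have key : ∀ u, FutureNull u → 0 < mink ξ u → 0 < mink w u →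
      heightMap φ u (mink ξ u + mink w u) - heightMap φ u (mink ξ u) =
        c * mink (φ w) (φ u) := by
    intro u hu h1 h2
    have h3 : mink (ξ + w) u = mink ξ u + mink w u := mink_add_left _ _ _
    have h4 := hφ.mink_invConj hu.1 hu.ne_zero e5.ne' (by rw [h3]; positivity)
    rw [hc, mink_add_left, mink_smul_left, hφ.mink_invConj hu.1 hu.ne_zero e4.ne' h1.ne',
      h3] at h4
    linarith
  have k1 := key v hv (by rwa [e1]) p2
  have k2 := key v' hv' (by rwa [e2]) p3
  rw [e1] at k1
  rw [e2] at k2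
  rw [k1, k2]
  ring

/-- The increments of `invConj φ` along a null vector `w` are the same everywhere. -/
theorem exists_increment (hφ : IsStrict φ) {w : Fin 4 → ℝ} (hw : FutureNull w) :
    ∃ c : ℝ, c ≠ 0 ∧ ∀ v, FutureNull v → mink w v ≠ 0 → ∀ s, 0 < s →
      heightMap φ v (s + mink w v) - heightMap φ v s = c * mink (φ w) (φ v) := by
  obtain ⟨v', hv', hwv'⟩ := exists_futureNull_generic [w] (by simpa using hw.ne_zero)
  have hwv' := hwv' w (by simp)
  have hne' := hφ.mink_ne_zero hw.1 hv'.1 hwv'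
  have p' := hw.mink_pos hv' hwv'
  refine ⟨(heightMap φ v' (1 + mink w v') - heightMap φ v' 1) / mink (φ w) (φ v'),
    div_ne_zero (sub_ne_zero.2 fun h => ?_) hne', ?_⟩
  · have := hφ.heightMap_injOn hv'.1 hv'.ne_zero (by positivity) one_ne_zero h
    linarith
  · intro v hv hwv s hs
    obtain ⟨u, hu, hgen⟩ := exists_futureNull_generic [v, v', w] (by
      simp only [List.mem_cons, List.not_mem_nil, or_false, forall_eq_or_imp, forall_eq]
      exact ⟨hv.ne_zero, hv'.ne_zero, hw.ne_zero⟩)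
    simp only [List.mem_cons, List.not_mem_nil, or_false, forall_eq_or_imp, forall_eq] at hgen
    obtain ⟨g1, g2, g3⟩ := hgen
    have h1 := hφ.heightMap_increment hv hu hw g1 hwv g3 hs one_pos
    have h2 := hφ.heightMap_increment hv' hu hw g2 hwv' g3 one_pos one_pos
    have hneu := hφ.mink_ne_zero hw.1 hu.1 g3
    apply mul_right_cancel₀ hneu
    rw [h1, div_mul_eq_mul_div, div_mul_eq_mul_div, eq_div_iff hne', mul_right_comm _ _
      (mink (φ w) (φ u)), h2]
    ring

end IsStrict

theorem mink_mul_last_pos {a b : Fin 4 → ℝ} (ha : mink a a = 0) (hb : mink b b = 0)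
    (h : mink a b ≠ 0) : 0 < mink a b * (a 3 * b 3) := by
  have a0 := ne_zero_of_mink_ne_zero h
  have b0 : b ≠ 0 := by
    rw [mink_comm] at h
    exact ne_zero_of_mink_ne_zero h
  rcases lt_or_gt_of_ne (mul_ne_zero (last_ne_zero_of_null ha a0) (last_ne_zero_of_null hb b0))
    with h3 | h3
  · have := mink_nonneg_of_null (v := -a) (w := b)
      (by rw [mink_neg_left, mink_neg_right, ha]; simp) hb
      (by simp only [Pi.neg_apply]; linarith)
    rw [mink_neg_left] at this
    exact mul_pos_of_neg_of_neg (lt_of_le_of_ne (by linarith) h) h3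
  · exact mul_pos (lt_of_le_of_ne (mink_nonneg_of_null ha hb h3.le) h.symm) h3

theorem FutureNull.exists_mink_eq_of_pos {v : Fin 4 → ℝ} (hv : FutureNull v) {δ : ℝ}
    (hδ : 0 < δ) : ∃ w, FutureNull w ∧ mink w v = δ := by
  obtain ⟨w, hw, hvw⟩ := exists_futureNull_generic [v] (by simpa using hv.ne_zero)
  have p := hv.mink_pos hw (hvw v (by simp))
  refine ⟨(δ / mink v w) • w, hw.smul (by positivity), ?_⟩
  rw [mink_smul_left, mink_comm w v]
  field_simp

namespace IsStrict

variable {φ : (Fin 4 → ℝ) → (Fin 4 → ℝ)}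

/-- After rescaling, `φ` is conformal on null vectors, and `invConj φ` is affine in each null
direction. -/
theorem exists_rescaling (hφ : IsStrict φ) :
    ∃ (c : ℝ) (ψ : (Fin 4 → ℝ) → (Fin 4 → ℝ)), c ≠ 0 ∧
      (∀ v w, FutureNull v → FutureNull w → mink (ψ v) (ψ w) = c * mink v w) ∧
      (∀ v, FutureNull v → ∃ a : ℝ, a ≠ 0 ∧ ψ v = a • φ v) ∧
      ∀ v, FutureNull v → ∃ C : ℝ, ∀ ξ, mink ξ ξ ≠ 0 → 0 < mink ξ v →
        mink (invConj φ ξ) (ψ v) = c * mink ξ v + C := by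
  choose! a ha0 ha using fun w (hw : FutureNull w) => hφ.exists_increment hw
  obtain ⟨K, hKdef⟩ : ∃ K : (Fin 4 → ℝ) → ℝ → ℝ,
    ∀ v δ, K v δ = heightMap φ v (1 + δ) - heightMap φ v 1 := ⟨_, fun _ _ => rfl⟩
  have hK : ∀ v, FutureNull v → ∀ δ s, 0 < δ → 0 < s →
      heightMap φ v (s + δ) - heightMap φ v s = K v δ := by
    intro v hv δ s hδ hs
    obtain ⟨w, hw, hwv⟩ := hv.exists_mink_eq_of_pos hδ
    have hne : mink w v ≠ 0 := by rw [hwv]; exact hδ.ne'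
    have h1 := ha w hw v hv hne s hs
    have h2 := ha w hw v hv hne 1 one_pos
    rw [hKdef, ← hwv, h1, h2]
  have hKφ : ∀ v w, FutureNull v → FutureNull w → mink w v ≠ 0 →
      K v (mink w v) = a w * mink (φ w) (φ v) := by
    intro v w hv hw hne
    rw [hKdef, ha w hw v hv hne 1 one_pos]
  have hKadd : ∀ v, FutureNull v → ∀ x y, 0 < x → 0 < y → K v (x + y) = K v x + K v y := by
    intro v hv x y hx hy
    rw [← hK v hv y (1 + x) hy (by positivity), hKdef, hKdef, add_assoc]
    ring
  have hK0 : ∀ v, FutureNull v → ∀ x, 0 < x → K v x ≠ 0 := by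
    intro v hv x hx h
    rw [hKdef, sub_eq_zero] at h
    have := hφ.heightMap_injOn hv.1 hv.ne_zero (by positivity) one_ne_zero h
    linarith
  have hsgn : ∀ v w, FutureNull v → FutureNull w → mink w v ≠ 0 →
      0 < K v (mink w v) * (a w * φ w 3 * φ v 3) := by
    intro v w hv hw hne
    have h1 := mink_mul_last_pos ((hφ.null_iff w).2 hw.1) ((hφ.null_iff v).2 hv.1)
      (hφ.mink_ne_zero hw.1 hv.1 hne)
    rw [hKφ v w hv hw hne]
    have h2 : 0 < a w ^ 2 := by
      have := ha0 w hw
      positivity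
    nlinarith [mul_pos h1 h2]
  have hcmp : ∀ v w w' : Fin 4 → ℝ, ∀ x y : ℝ, 0 < x * (a w * φ w 3 * φ v 3) →
      0 < y * (a w' * φ w' 3 * φ v 3) → 0 < (x * y) * ((a w * φ w 3) * (a w' * φ w' 3)) := by
    intro v w w' x y hx hy
    have h3 : 0 < φ v 3 ^ 2 := by
      have : φ v 3 ≠ 0 := by
        intro h
        rw [h] at hx
        simp at hx
      positivity
    have := mul_pos hx hy
    refine pos_of_mul_pos_left (b := φ v 3 ^ 2) ?_ h3.le
    linarith
  have horient : ∀ w w', FutureNull w → FutureNull w' → mink w' w ≠ 0 →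
      0 < (a w * φ w 3) * (a w' * φ w' 3) := by
    intro w w' hw hw' hne
    obtain ⟨v, hv, h1, h2⟩ := hw.exists_mink_eq hw' hne
    rw [mink_comm] at h1 h2
    have e1 := hsgn v w hv hw (by rw [h1]; exact one_ne_zero)
    have e2 := hsgn v w' hv hw' (by rw [h2]; exact one_ne_zero)
    rw [h1] at e1
    rw [h2] at e2
    have h3 := hcmp v w w' _ _ e1 e2
    have h4 : 0 < K v 1 * K v 1 := mul_self_pos.2 (hK0 v hv 1 one_pos)
    exact pos_of_mul_pos_right h3 h4.le
  have horient' : ∀ w w', FutureNull w → FutureNull w' →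
      0 < (a w * φ w 3) * (a w' * φ w' 3) := by
    intro w w' hw hw'
    obtain ⟨u, hu, hgen⟩ := exists_futureNull_generic [w, w'] (by
      simp only [List.mem_cons, List.not_mem_nil, or_false, forall_eq_or_imp, forall_eq]
      exact ⟨hw.ne_zero, hw'.ne_zero⟩)
    simp only [List.mem_cons, List.not_mem_nil, or_false, forall_eq_or_imp, forall_eq] at hgen
    have h1 := horient u w hu hw hgen.1
    have h2 := horient u w' hu hw' hgen.2
    have h3 : 0 < (a u * φ u 3) ^ 2 := by
      have : a u * φ u 3 ≠ 0 := by
        intro h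
        rw [h] at h1
        simp at h1
      positivity
    refine pos_of_mul_pos_left (b := (a u * φ u 3) ^ 2) ?_ h3.le
    have := mul_pos h1 h2
    linarith
  have hlin : ∀ v, FutureNull v → ∀ x, 0 < x → K v x = x * K v 1 := by
    intro v hv
    refine eq_mul_of_additive (hKadd v hv) fun x hx => ?_
    obtain ⟨w, hw, hwv⟩ := hv.exists_mink_eq_of_pos hx
    obtain ⟨w', hw', hwv'⟩ := hv.exists_mink_eq_of_pos one_pos
    have e1 := hsgn v w hv hw (by rw [hwv]; exact hx.ne')
    have e2 := hsgn v w' hv hw' (by rw [hwv']; exact one_ne_zero)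
    rw [hwv] at e1
    rw [hwv'] at e2
    exact pos_of_mul_pos_left (hcmp v w w' _ _ e1 e2) (horient' w w' hw hw').le
  have hprod : ∀ v w, FutureNull v → FutureNull w → mink w v ≠ 0 →
      mink (a w • φ w) (a v • φ v) = a v * K v 1 * mink w v := by
    intro v w hv hw hne
    rw [mink_smul_left, mink_smul_right]
    have h1 := hKφ v w hv hw hne
    rw [hlin v hv _ (hw.mink_pos hv hne)] at h1
    linear_combination (-a v) * h1
  have hconst : ∀ v w, FutureNull v → FutureNull w → mink w v ≠ 0 →
      a v * K v 1 = a w * K w 1 := by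
    intro v w hv hw hne
    have h1 := hprod v w hv hw hne
    have h2 := hprod w v hw hv (by rwa [mink_comm])
    rw [mink_comm, h1, mink_comm v w] at h2
    exact mul_right_cancel₀ hne h2
  obtain ⟨n, hn, -⟩ := exists_futureNull_generic [] (by simp)
  have hconst' : ∀ v, FutureNull v → a v * K v 1 = a n * K n 1 := by
    intro v hv
    obtain ⟨u, hu, hgen⟩ := exists_futureNull_generic [v, n] (by
      simp only [List.mem_cons, List.not_mem_nil, or_false, forall_eq_or_imp, forall_eq]
      exact ⟨hv.ne_zero, hn.ne_zero⟩)
    simp only [List.mem_cons, List.not_mem_nil, or_false, forall_eq_or_imp, forall_eq] at hgen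
    rw [← hconst u v hu hv hgen.1, ← hconst u n hu hn hgen.2]
  refine ⟨a n * K n 1, fun v => a v • φ v, mul_ne_zero (ha0 n hn) (hK0 n hn 1 one_pos), ?_,
    fun v hv => ⟨a v, ha0 v hv, rfl⟩, ?_⟩
  · intro v w hv hw
    by_cases hne : mink v w = 0
    · obtain ⟨t, ht⟩ := null_parallel_of_orthogonal hv.1 hv.ne_zero hw.1 hne
      rw [hne, mul_zero]
      beta_reduce
      rw [mink_smul_left, mink_smul_right]
      nth_rw 2 [ht]
      rw [hφ.map_smul_null hv.1 hv.ne_zero, mink_smul_right, (hφ.null_iff v).2 hv.1]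
      ring
    · rw [← hconst' w hw, ← hprod w v hw hv hne]
  · intro v hv
    refine ⟨a v * (heightMap φ v 1 - K v 1), fun ξ hξ hpos => ?_⟩
    rw [mink_smul_right, hφ.mink_invConj hv.1 hv.ne_zero hξ hpos.ne', ← hconst' v hv]
    have h1 := hK v hv 1 _ one_pos hpos
    have h2 := hKdef v (mink ξ v)
    rw [hlin v hv _ hpos, add_comm 1] at h2
    linear_combination (-a v) * (h1 + h2)

end IsStrict

theorem surjective_of_conformal {c : ℝ} (hc : c ≠ 0) {T : (Fin 4 → ℝ) →ₗ[ℝ] (Fin 4 → ℝ)}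
    (hT : ∀ x y, mink (T x) (T y) = c * mink x y) : Function.Surjective T := by
  refine LinearMap.injective_iff_surjective.1 ((injective_iff_map_eq_zero T).2 fun x hx => ?_)
  refine eq_zero_of_orthogonal fun y => ?_
  have := hT x y
  rw [hx, mink_zero_left] at this
  simpa [hc] using this.symm

theorem pos_of_conformal {c : ℝ} (hc : c ≠ 0) {T : (Fin 4 → ℝ) →ₗ[ℝ] (Fin 4 → ℝ)}
    (hT : ∀ x y, mink (T x) (T y) = c * mink x y) : 0 < c := by
  by_contra hneg
  have hneg : c < 0 := lt_of_le_of_ne (not_lt.1 hneg) hc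
  obtain ⟨a, ha⟩ : ∃ a, a = T ![1, 0, 0, 0] := ⟨_, rfl⟩
  obtain ⟨b, hb⟩ : ∃ b, b = T ![0, 1, 0, 0] := ⟨_, rfl⟩
  have h1 := hT ![1, 0, 0, 0] ![1, 0, 0, 0]
  have h2 := hT ![0, 1, 0, 0] ![0, 1, 0, 0]
  have h3 := hT ![1, 0, 0, 0] ![0, 1, 0, 0]
  rw [← ha] at h1 h3
  rw [← hb] at h2 h3
  simp [mink] at h1 h2 h3
  have p1 : a 0 ^ 2 + a 1 ^ 2 + a 2 ^ 2 < a 3 ^ 2 := by linarith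
  have p2 : b 0 ^ 2 + b 1 ^ 2 + b 2 ^ 2 < b 3 ^ 2 := by linarith
  have cs : (a 0 * b 0 + a 1 * b 1 + a 2 * b 2) ^ 2 ≤
      (a 0 ^ 2 + a 1 ^ 2 + a 2 ^ 2) * (b 0 ^ 2 + b 1 ^ 2 + b 2 ^ 2) := by
    nlinarith [sq_nonneg (a 0 * b 1 - a 1 * b 0), sq_nonneg (a 0 * b 2 - a 2 * b 0),
      sq_nonneg (a 1 * b 2 - a 2 * b 1)]
  have lt : (a 0 ^ 2 + a 1 ^ 2 + a 2 ^ 2) * (b 0 ^ 2 + b 1 ^ 2 + b 2 ^ 2) < a 3 ^ 2 * b 3 ^ 2 :=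
    mul_lt_mul'' p1 p2 (by positivity) (by positivity)
  have e : a 0 * b 0 + a 1 * b 1 + a 2 * b 2 = a 3 * b 3 := by linarith
  rw [e, mul_pow] at cs
  linarith

/-- A conformal map of the future light cone extends to a linear map. -/
theorem exists_linear_extension {c : ℝ} (hc : c ≠ 0) {ψ : (Fin 4 → ℝ) → (Fin 4 → ℝ)}
    (hψ : ∀ v w, FutureNull v → FutureNull w → mink (ψ v) (ψ w) = c * mink v w) :
    ∃ T : (Fin 4 → ℝ) →ₗ[ℝ] (Fin 4 → ℝ), (∀ x y, mink (T x) (T y) = c * mink x y) ∧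
      ∀ v, FutureNull v → T v = ψ v := by
  have f0 : FutureNull ![1, 0, 0, 1] := by constructor <;> simp [mink]
  have f1 : FutureNull ![0, 1, 0, 1] := by constructor <;> simp [mink]
  have f2 : FutureNull ![0, 0, 1, 1] := by constructor <;> simp [mink]
  have f3 : FutureNull ![-1, 0, 0, 1] := by constructor <;> simp [mink]
  let T : (Fin 4 → ℝ) →ₗ[ℝ] (Fin 4 → ℝ) :=
    { toFun := fun x => ((x 3 + x 0 - x 1 - x 2) / 2) • ψ ![1, 0, 0, 1] + x 1 • ψ ![0, 1, 0, 1]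
        + x 2 • ψ ![0, 0, 1, 1] + ((x 3 - x 0 - x 1 - x 2) / 2) • ψ ![-1, 0, 0, 1]
      map_add' := fun x y => by simp only [Pi.add_apply]; module
      map_smul' := fun t x => by
        simp only [Pi.smul_apply, smul_eq_mul, RingHom.id_apply]; module }
  have hTdef : ∀ x, T x = ((x 3 + x 0 - x 1 - x 2) / 2) • ψ ![1, 0, 0, 1]
      + x 1 • ψ ![0, 1, 0, 1] + x 2 • ψ ![0, 0, 1, 1]
      + ((x 3 - x 0 - x 1 - x 2) / 2) • ψ ![-1, 0, 0, 1] := fun _ => rfl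
  clear_value T
  have hψT : ∀ v x, FutureNull v → mink (ψ v) (T x) = c * mink v x := by
    intro v x hv
    rw [hTdef]
    simp only [mink_add_right, mink_smul_right, hψ _ _ hv f0, hψ _ _ hv f1, hψ _ _ hv f2,
      hψ _ _ hv f3]
    simp [mink]
    ring
  have hT : ∀ x y, mink (T x) (T y) = c * mink x y := by
    intro x y
    rw [hTdef x]
    simp only [mink_add_left, mink_smul_left, hψT _ _ f0, hψT _ _ f1, hψT _ _ f2, hψT _ _ f3]
    simp [mink]
    ring
  refine ⟨T, hT, fun v hv => ?_⟩
  rw [← sub_eq_zero]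
  refine eq_zero_of_orthogonal fun y => ?_
  obtain ⟨x, rfl⟩ := surjective_of_conformal hc hT y
  rw [mink_sub_left, hT, hψT _ _ hv, sub_self]

/-- The future null vectors in an open half space with spacelike normal span. -/
theorem exists_futureNull_pos {ξ d : Fin 4 → ℝ} (hξ : mink ξ ξ < 0) (hd : d ≠ 0) :
    ∃ v, FutureNull v ∧ 0 < mink ξ v ∧ mink d v ≠ 0 := by
  obtain ⟨w, hw, hgen⟩ := exists_futureNull_generic [ξ, d, scaledRefl ξ d] (by
    simp only [List.mem_cons, List.not_mem_nil, or_false, forall_eq_or_imp, forall_eq]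
    exact ⟨ne_zero_of_mink_ne_zero hξ.ne, hd, scaledRefl_ne_zero hξ.ne hd⟩)
  simp only [List.mem_cons, List.not_mem_nil, or_false, forall_eq_or_imp, forall_eq] at hgen
  obtain ⟨g1, g2, g3⟩ := hgen
  rcases lt_or_gt_of_ne g1 with h | h
  · have hpos : 0 < -(mink ξ ξ)⁻¹ := neg_pos.2 (inv_lt_zero.2 hξ)
    have hinv : (mink ξ ξ)⁻¹ * mink ξ ξ = 1 := inv_mul_cancel₀ hξ.ne
    have hnull : mink ((mink ξ ξ)⁻¹ • scaledRefl ξ w) ((mink ξ ξ)⁻¹ • scaledRefl ξ w) = 0 := by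
      rw [mink_smul_left, mink_smul_right, mink_scaledRefl_self, hw.1]
      ring
    refine ⟨(mink ξ ξ)⁻¹ • scaledRefl ξ w, hw.of_mink_pos hnull ?_, ?_, ?_⟩
    · rw [mink_smul_left, mink_scaledRefl_left, hw.1]
      have : 0 < mink ξ w ^ 2 := by positivity
      nlinarith [mul_pos hpos this]
    · rw [mink_smul_right, mink_comm ξ (scaledRefl ξ w), mink_scaledRefl_left, mink_comm w ξ]
      have : (mink ξ ξ)⁻¹ * (mink ξ ξ * mink ξ w - 2 * mink ξ ξ * mink ξ w) = -mink ξ w := by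
        linear_combination (-mink ξ w) * hinv
      nlinarith
    · rw [mink_smul_right, mink_scaledRefl_comm]
      exact mul_ne_zero (inv_ne_zero hξ.ne) g3
  · exact ⟨w, hw, h, g2⟩

namespace IsStrict

variable {φ : (Fin 4 → ℝ) → (Fin 4 → ℝ)}

theorem eq_smul_linear (hφ : IsStrict φ) :
    ∃ (c : ℝ) (T : (Fin 4 → ℝ) →ₗ[ℝ] (Fin 4 → ℝ)), 0 < c ∧
      (∀ x y, mink (T x) (T y) = c * mink x y) ∧ ∀ x, φ x = c⁻¹ • T x := by
  obtain ⟨c, ψ, hc, hψ, hψφ, hF⟩ := hφ.exists_rescaling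
  obtain ⟨T, hT, hTψ⟩ := exists_linear_extension hc hψ
  have hsurj := surjective_of_conformal hc hT
  refine ⟨c, T, pos_of_conformal hc hT, hT, ?_⟩
  obtain ⟨u, hu⟩ := hsurj (invConj φ ![0, 0, 0, 1] - T ![0, 0, 0, 1])
  have hshift : ∀ ξ, mink ξ ξ < 0 → invConj φ ξ = T (ξ + u) := by
    intro ξ hξ
    obtain ⟨d, hd⟩ := hsurj (invConj φ ξ - T (ξ + u))
    by_contra hne
    have hd0 : d ≠ 0 := by
      rintro rfl
      rw [map_zero] at hd
      exact hne (sub_eq_zero.1 hd.symm)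
    obtain ⟨v, hv, h1, h2⟩ := exists_futureNull_pos hξ hd0
    obtain ⟨C, hC⟩ := hF v hv
    have e1 := hC ξ hξ.ne h1
    have e2 := hC ![0, 0, 0, 1] (by simp [mink]) (by simpa [mink] using hv.2)
    rw [← hTψ v hv] at e1 e2
    apply h2
    have e3 := hT d v
    have e4 := hT u v
    rw [hd, mink_sub_left, e1, hT, mink_add_left] at e3
    rw [hu, mink_sub_left, e2, hT] at e4
    apply mul_left_cancel₀ hc
    linarith
  have hu0 : u = 0 := by
    by_contra hu0
    obtain ⟨w, hw, hgen⟩ := exists_futureNull_generic [u] (by simpa using hu0)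
    have h1 := hgen u (by simp)
    obtain ⟨t, ht⟩ : ∃ t, t = (mink u u + 1) / (2 * mink u w) := ⟨_, rfl⟩
    have h2 : mink (t • w - u) (t • w - u) = -1 := by
      simp only [mink_sub_left, mink_sub_right, mink_smul_left, mink_smul_right, hw.1,
        mink_comm w u]
      rw [ht]
      field_simp
      ring
    refine hφ.invConj_ne (ξ := t • w - u) (by rw [h2]; norm_num) ?_
    rw [hshift _ (by rw [h2]; norm_num), hT, sub_add_cancel, mink_smul_left, mink_smul_right,
      hw.1]
    ring
  subst hu0
  simp only [add_zero] at hshift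
  have hnull : ∀ z, mink z z = 0 → φ z = c⁻¹ • T z := by
    intro z hz
    by_cases hz0 : z = 0
    · rw [hz0, hφ.zero, map_zero, smul_zero]
    obtain ⟨t, v, ht, hv, hzv⟩ : ∃ (t : ℝ) (v : Fin 4 → ℝ), t ≠ 0 ∧ FutureNull v ∧ z = t • v := by
      rcases lt_or_gt_of_ne (last_ne_zero_of_null hz hz0) with h | h
      · refine ⟨-1, -z, by norm_num, ⟨?_, by simpa using h⟩, by simp⟩
        rw [mink_neg_left, mink_neg_right, hz]
        simp
      · exact ⟨1, z, one_ne_zero, ⟨hz, h⟩, by simp⟩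
    obtain ⟨μ, hμ⟩ : ∃ μ : ℝ, φ z = μ • T z := by
      obtain ⟨a, ha, hψv⟩ := hψφ v hv
      refine ⟨φ (t • v) 3 / φ v 3 * (t * a)⁻¹, ?_⟩
      rw [hzv, map_smul, hTψ v hv, hψv, smul_smul, smul_smul,
        mul_assoc _ t a, inv_mul_cancel_right₀ (mul_ne_zero ht ha)]
      exact hφ.map_smul_null hv.1 hv.ne_zero t
    obtain ⟨w, ww, -, hgen⟩ := exists_null_generic [z] (by simpa using hz0)
    have h1 := hgen z (by simp)
    obtain ⟨ξ, hξ⟩ : ∃ ξ, ξ = (2 * mink z w)⁻¹ • w - z := ⟨_, rfl⟩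
    have h2 : mink ξ z = 1 / 2 := by
      rw [hξ, mink_sub_left, mink_smul_left, hz, mink_comm w z]
      field_simp
      ring
    have h3 : mink ξ ξ = -1 := by
      rw [hξ]
      simp only [mink_sub_left, mink_sub_right, mink_smul_left, mink_smul_right, hz, ww,
        mink_comm w z]
      field_simp
      ring
    have h4 := hφ.mink_invConj_planeInv hz (ξ := ξ) (by rw [h3]; norm_num)
      (by rw [h2]; norm_num)
    rw [h2, planeInv_half, hshift ξ (by rw [h3]; norm_num), hμ, mink_smul_right, hT, h2] at h4
    rw [hμ]
    congr 1
    field_simp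
    linarith
  have hconj : ∀ ξ, mink ξ ξ ≠ 0 → invConj φ ξ = T ξ := by
    intro ξ hξ
    obtain ⟨d, hd⟩ := hsurj (invConj φ ξ - T ξ)
    by_contra hne
    have hd0 : d ≠ 0 := by
      rintro rfl
      rw [map_zero] at hd
      exact hne (sub_eq_zero.1 hd.symm)
    obtain ⟨v, vv, -, hgen⟩ := exists_null_generic [ξ, d] (by
      simp only [List.mem_cons, List.not_mem_nil, or_false, forall_eq_or_imp, forall_eq]
      exact ⟨ne_zero_of_mink_ne_zero hξ, hd0⟩)
    simp only [List.mem_cons, List.not_mem_nil, or_false, forall_eq_or_imp, forall_eq] at hgen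
    obtain ⟨g1, g2⟩ := hgen
    have h1 := hφ.mink_invConj_planeInv vv hξ g1
    have h2 : φ (planeInv v (mink ξ v)) = (c⁻¹ * (2 * mink ξ v)⁻¹) • T v := by
      rw [hnull, planeInv, map_smul, smul_smul]
      rw [planeInv, mink_smul_left, mink_smul_right, vv]
      ring
    have h3 := hT d v
    rw [h2, mink_smul_right] at h1
    rw [hd, mink_sub_left, hT] at h3
    apply g2
    apply mul_left_cancel₀ hc
    rw [← h3]
    field_simp at h1
    linarith
  intro x
  by_cases hx : mink x x = 0
  · exact hnull x hx
  have hx' : mink (hypInv x) (hypInv x) ≠ 0 := by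
    rw [mink_hypInv]
    exact inv_ne_zero hx
  have h1 := hconj (hypInv x) hx'
  unfold invConj at h1
  rw [hypInv_hypInv hx] at h1
  have h2 : mink (φ x) (φ x) ≠ 0 := by rwa [Ne, hφ.null_iff]
  rw [← hypInv_hypInv h2, h1]
  have h3 : hypInv (T (hypInv x)) = (mink (T (hypInv x)) (T (hypInv x)))⁻¹ • T (hypInv x) := rfl
  rw [h3, hT, mink_hypInv, hypInv, map_smul, smul_smul]
  congr 1
  field_simp

end IsStrict

theorem isLorentz_of_mink {Q : Matrix (Fin 4) (Fin 4) ℝ}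
    (hQ : ∀ x y, mink (Q.mulVec x) (Q.mulVec y) = mink x y) : IsLorentz Q := by
  unfold IsLorentz
  ext i j
  have h := hQ (Pi.single i 1) (Pi.single j 1)
  simp only [Matrix.mulVec_single_one, mink, Matrix.col_apply] at h
  simp only [minkM, Matrix.mul_apply, Matrix.transpose_apply, Fin.sum_univ_four]
  fin_cases i <;> fin_cases j <;> simp at h ⊢ <;> linarith

/-- **Optimal version of the fundamental theorem of chronogeometry.**  A lightlikeness
preserving map of `ℝ⁴` (no regularity assumed) is either a Poincaré-type similarity, or its
image off one point lies in a light cone, or its image off one lightlike line lies in a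
lightlike line. -/
theorem optimal_fundamental_theorem_of_chronogeometry
    (φ : (Fin 4 → ℝ) → (Fin 4 → ℝ))
    (h : ∀ r₁ r₂ : Fin 4 → ℝ,
      mink (r₁ - r₂) (r₁ - r₂) = 0 → mink (φ r₁ - φ r₂) (φ r₁ - φ r₂) = 0) :
    (∃ (c : ℝ) (Q : Matrix (Fin 4) (Fin 4) ℝ) (a : Fin 4 → ℝ),
      0 < c ∧ IsLorentz Q ∧ ∀ r : Fin 4 → ℝ, φ r = c • Q.mulVec r + a) ∨
    (∃ r r' : Fin 4 → ℝ, ∀ s : Fin 4 → ℝ, s ≠ r →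
      mink (φ s - r') (φ s - r') = 0) ∨
    (∃ ℓ ℓ' : Set (Fin 4 → ℝ), IsLightlikeLine ℓ ∧ IsLightlikeLine ℓ' ∧
      ∀ s : Fin 4 → ℝ, s ∉ ℓ → φ s ∈ ℓ') := by
  have hφ : Preserving φ := h
  by_cases hN : ∃ r r' : Fin 4 → ℝ, ∀ s, s ≠ r → Adj (φ s) r'
  · exact Or.inr (Or.inl hN)
  push Not at hN
  by_cases hfat : ∃ r, Fat φ r
  · obtain ⟨r, hr⟩ := hfat
    exact Or.inr (Or.inr (hφ.exists_line_of_fat hr hN))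
  have hinj : ∀ x y, Adj x y → φ x = φ y → x = y := fun x y hxy e => by
    by_contra hne
    exact hfat ⟨φ y, x, y, hxy, hne, e, rfl⟩
  by_cases hrefl : ∃ x y, ¬Adj x y ∧ Adj (φ x) (φ y)
  · obtain ⟨x, y, hxy, hadj⟩ := hrefl
    exact Or.inr (Or.inr (hφ.exists_line_of_not_adj hinj hxy hadj))
  push Not at hrefl
  left
  have hadj : ∀ x y, Adj (φ x) (φ y) → Adj x y := fun x y hxy => by
    by_contra hne
    exact hrefl x y hne hxy
  have hstrict : IsStrict fun x => φ x - φ 0 :=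
    { zero := sub_self _
      adj := fun x y => by
        have : Adj (φ x - φ 0) (φ y - φ 0) ↔ Adj (φ x) (φ y) := by
          unfold Adj
          rw [sub_sub_sub_cancel_right]
        exact this.trans ⟨hadj x y, hφ x y⟩
      inj := fun x y hxy => by
        have e : φ x = φ y := sub_left_injective hxy
        refine hinj x y (hadj x y ?_) e
        simp [Adj, e, mink] }
  obtain ⟨c, T, hc, hT, hφT⟩ := hstrict.eq_smul_linear
  have hs : 0 < (√c)⁻¹ := inv_pos.2 (Real.sqrt_pos.2 hc)
  have hss : (√c)⁻¹ * (√c)⁻¹ = c⁻¹ := by rw [← mul_inv, Real.mul_self_sqrt hc.le]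
  have hQ : ∀ x, (LinearMap.toMatrix' ((√c)⁻¹ • T)).mulVec x = (√c)⁻¹ • T x := fun x => by
    rw [LinearMap.toMatrix'_mulVec, LinearMap.smul_apply]
  refine ⟨(√c)⁻¹, LinearMap.toMatrix' ((√c)⁻¹ • T), φ 0, hs, isLorentz_of_mink fun x y => ?_,
    fun x => ?_⟩
  · rw [hQ, hQ, mink_smul_left, mink_smul_right, hT, ← mul_assoc, hss, inv_mul_cancel_left₀ hc.ne']
  · rw [hQ, smul_smul, hss, ← hφT, sub_add_cancel]
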